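/- arXiv:2203.12021 — 3 statements merged into one kernel-verified Lean document; each statement's English description precedes it below -/
import Mathlib

section
/- Every finite weakly-top group is solvable. -/
def IsWeaklyTop (G : Type*) [Group G] : Prop :=
  ∀ H : Subgroup G, Nat.card (Abelianization H) ≤ Nat.card (Abelianization G)


namespace WT
open Subgroup

universe u v

/-- nilpotent group: absorption -/
theorem nilp_sup {Γ : Type*} [Group Γ] [Group.IsNilpotent Γ] (C X : Subgroup Γ) [C.Normal]
    (h : X ≤ C ⊔ ⁅X, (⊤ : Subgroup Γ)⁆) : X ≤ C := by
  have hq : Function.Surjective (QuotientGroup.mk' C) := QuotientGroup.mk'_surjective C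
  have : Group.IsNilpotent (Γ ⧸ C) := Group.nilpotent_of_surjective (QuotientGroup.mk' C) hq
  set Y := X.map (QuotientGroup.mk' C) with hY
  have h1 : Y ≤ ⁅Y, (⊤ : Subgroup (Γ ⧸ C))⁆ := by
    have := Subgroup.map_mono (f := QuotientGroup.mk' C) h
    rw [Subgroup.map_sup, Subgroup.map_commutator, QuotientGroup.map_mk'_self, bot_sup_eq,
      Subgroup.map_top_of_surjective _ hq] at this
    exact this
  obtain ⟨n, hn⟩ := Subgroup.nilpotent_iff_lowerCentralSeries.1 this
  have h2 : ∀ n, Y ≤ Subgroup.lowerCentralSeries (⊤ : Subgroup (Γ ⧸ C)) n := by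
    intro n
    induction n with
    | zero => simp
    | succ k ih =>
      exact h1.trans (Subgroup.commutator_mono ih le_rfl)
  have h3 : Y = ⊥ := by
    rw [eq_bot_iff]; exact (h2 n).trans hn.le
  rw [hY, Subgroup.map_eq_bot_iff, QuotientGroup.ker_mk'] at h3
  exact h3

theorem index_sup_formula {Γ : Type*} [Group Γ] (C : Subgroup Γ) :
    (commutator Γ).index = (commutator Γ ⊔ C).index * (commutator Γ).relIndex C := by
  rw [← Subgroup.relIndex_mul_index (le_sup_left : commutator Γ ≤ commutator Γ ⊔ C),
    sup_comm, Subgroup.relIndex_sup_right, mul_comm]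

theorem relIndex_comm_self {Γ : Type*} [Group Γ] (C : Subgroup Γ) :
    (⁅C, C⁆).relIndex C = (commutator C).index := by
  rw [Subgroup.relIndex, ← Subgroup.map_subtype_commutator, Subgroup.subgroupOf,
    Subgroup.comap_map_eq_self_of_injective C.subtype_injective]

theorem comm_le_commutator {Γ : Type*} [Group Γ] (C : Subgroup Γ) : ⁅C, C⁆ ≤ commutator Γ :=
  Subgroup.commutator_mono le_top le_top

theorem index_le_formula {Γ : Type*} [Group Γ] [Finite Γ] (C : Subgroup Γ) :
    (commutator Γ).index ≤ (commutator Γ ⊔ C).index * (⁅C, C⁆).relIndex C := by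
  rw [index_sup_formula C]
  apply Nat.mul_le_mul_left
  exact Subgroup.relIndex_le_of_le_left (comm_le_commutator C)
    (Subgroup.index_ne_zero_of_finite)

/-- coprime elements commute -/
theorem nilp_commute {Γ : Type*} [Group Γ] [Finite Γ] [Group.IsNilpotent Γ] (x y : Γ)
    (h : (orderOf x).Coprime (orderOf y)) : x * y = y * x := by
  obtain ⟨e⟩ := ((Group.isNilpotent_of_finite_tfae (G := Γ)).out 0 4).1 ‹Group.IsNilpotent Γ›
  apply e.symm.injective
  rw [map_mul, map_mul]
  funext p P
  simp only [Pi.mul_apply]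
  set a := e.symm x p P with ha
  set b := e.symm y p P with hb
  have : Fact (Nat.Prime (p : ℕ)) := ⟨Nat.prime_of_mem_primeFactors p.2⟩
  let π : (∀ p : (Nat.card Γ).primeFactors, ∀ P : Sylow p Γ, (P : Subgroup Γ)) →* P :=
    { toFun := fun f => f p P, map_one' := rfl, map_mul' := fun _ _ => rfl }
  have h1 : orderOf a ∣ orderOf x := orderOf_map_dvd (π.comp e.symm.toMonoidHom) x
  have h2 : orderOf b ∣ orderOf y := orderOf_map_dvd (π.comp e.symm.toMonoidHom) y
  have h3 := Nat.Coprime.of_dvd h1 h2 h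
  obtain ⟨i, hi⟩ := IsPGroup.iff_orderOf.1 P.isPGroup' a
  obtain ⟨j, hj⟩ := IsPGroup.iff_orderOf.1 P.isPGroup' b
  have : a = 1 ∨ b = 1 := by
    rcases Nat.eq_zero_or_pos i with h | h
    · left; rw [← orderOf_eq_one_iff, hi, h, pow_zero]
    rcases Nat.eq_zero_or_pos j with h' | h'
    · right; rw [← orderOf_eq_one_iff, hj, h', pow_zero]
    exfalso
    rw [hi, hj] at h3
    have := Nat.Coprime.of_dvd (dvd_pow_self (p:ℕ) h.ne') (dvd_pow_self (p:ℕ) h'.ne') h3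
    rw [Nat.coprime_self] at this
    exact (Fact.out : Nat.Prime (p:ℕ)).one_lt.ne' this
  rcases this with h | h <;> simp [h]

section Actions
variable {A : Type u} [Group A] {V : Type v} [AddCommGroup V]

theorem end_mul (f g : AddMonoid.End V) (v : V) : (f * g) v = f (g v) := rfl
theorem end_one (v : V) : (1 : AddMonoid.End V) v = v := rfl

/-- pointwise stabilizer -/
def fix (ρ : A →* AddMonoid.End V) (U : AddSubgroup V) : Subgroup A where
  carrier := {a | ∀ v ∈ U, ρ a v = v}
  one_mem' := by intro v _; simp [end_one]
  mul_mem' := by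
    intro a b ha hb v hv
    rw [map_mul, end_mul, hb v hv, ha v hv]
  inv_mem' := by
    intro a ha v hv
    conv_lhs => rw [← ha v hv]
    rw [← end_mul, ← map_mul]; simp [end_one]

def Inv (ρ : A →* AddMonoid.End V) (U : AddSubgroup V) : Prop := ∀ a, ∀ v ∈ U, ρ a v ∈ U

theorem mem_fix {ρ : A →* AddMonoid.End V} {U : AddSubgroup V} {a : A} :
    a ∈ fix ρ U ↔ ∀ v ∈ U, ρ a v = v := Iff.rfl

@[simp] theorem rho_inv_self (ρ : A →* AddMonoid.End V) (a : A) (v : V) : ρ a⁻¹ (ρ a v) = v := by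
  rw [← end_mul, ← map_mul]; simp [end_one]
@[simp] theorem rho_self_inv (ρ : A →* AddMonoid.End V) (a : A) (v : V) : ρ a (ρ a⁻¹ v) = v := by
  rw [← end_mul, ← map_mul]; simp [end_one]

theorem rho_mul (ρ : A →* AddMonoid.End V) (a b : A) (v : V) : ρ (a * b) v = ρ a (ρ b v) := by
  rw [map_mul, end_mul]

theorem rho_inj (ρ : A →* AddMonoid.End V) (a : A) : Function.Injective (ρ a) := by
  intro x y h
  rw [← rho_inv_self ρ a x, h, rho_inv_self]

theorem fix_normal {ρ : A →* AddMonoid.End V} {U : AddSubgroup V} (hU : Inv ρ U) :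
    (fix ρ U).Normal := by
  constructor
  intro n hn g v hv
  rw [rho_mul, rho_mul, hn _ (hU _ _ hv), rho_self_inv]

/-- restricted action -/
def restr (ρ : A →* AddMonoid.End V) (U : AddSubgroup V) (hU : Inv ρ U) :
    A →* AddMonoid.End U where
  toFun a := ((ρ a).comp U.subtype).codRestrict U (fun v => hU a v v.2)
  map_one' := by
    ext v
    change ρ 1 (v : V) = v
    rw [map_one]; rfl
  map_mul' a b := by
    ext v
    change ρ (a * b) (v : V) = ρ a (ρ b v)
    rw [rho_mul]

@[simp] theorem restr_apply (ρ : A →* AddMonoid.End V) (U : AddSubgroup V) (hU : Inv ρ U) (a : A)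
    (v : U) : ((restr ρ U hU a v : U) : V) = ρ a v := rfl

theorem restr_ker (ρ : A →* AddMonoid.End V) (U : AddSubgroup V) (hU : Inv ρ U) :
    (restr ρ U hU).ker = fix ρ U := by
  ext a
  rw [MonoidHom.mem_ker, mem_fix]
  constructor
  · intro h v hv
    have := congrArg (fun f : AddMonoid.End U => ((f ⟨v, hv⟩ : U) : V)) h
    simpa using this
  · intro h
    ext v
    simpa using h v v.2

/-- quotient action -/
def quo (ρ : A →* AddMonoid.End V) (U : AddSubgroup V) (hU : Inv ρ U) :
    A →* AddMonoid.End (V ⧸ U) where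
  toFun a := QuotientAddGroup.map U U (ρ a) (fun v hv => hU a v hv)
  map_one' := by
    apply AddMonoidHom.ext; intro v
    induction v using QuotientAddGroup.induction_on with | H z =>
      change ((ρ 1 z : V) : V ⧸ U) = (z : V ⧸ U)
      rw [map_one]; rfl
  map_mul' a b := by
    apply AddMonoidHom.ext; intro v
    induction v using QuotientAddGroup.induction_on with | H z =>
      change ((ρ (a * b) z : V) : V ⧸ U) = ((ρ a (ρ b z) : V) : V ⧸ U)
      rw [rho_mul]

@[simp] theorem quo_mk (ρ : A →* AddMonoid.End V) (U : AddSubgroup V) (hU : Inv ρ U) (a : A)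
    (v : V) : quo ρ U hU a (v : V ⧸ U) = ((ρ a v : V) : V ⧸ U) := rfl

/-- coprime: unipotent elements are trivial -/
theorem coprime_unip [Finite A] [Finite V] (ρ : A →* AddMonoid.End V)
    (hco : (Nat.card A).Coprime (Nat.card V)) (a : A) (W : AddSubgroup V)
    (h1 : ∀ w ∈ W, ρ a w = w) (h2 : ∀ v, ρ a v - v ∈ W) : ρ a = 1 := by
  apply AddMonoidHom.ext; intro v
  set w := ρ a v - v with hw
  have h3 : ∀ n : ℕ, ρ (a ^ n) v = v + n • w := by
    intro n
    induction n with
    | zero => simp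
    | succ k ih =>
      rw [pow_succ', rho_mul, ih, map_add, map_nsmul, h1 w (h2 v), succ_nsmul, hw]
      abel
  have h4 := h3 (Nat.card A)
  rw [pow_card_eq_one', map_one, AddMonoid.End.coe_one, id, left_eq_add] at h4
  have h5 : w = 0 := by
    rw [← AddMonoid.addOrderOf_eq_one_iff]
    apply Nat.eq_one_of_dvd_coprimes hco (addOrderOf_dvd_of_nsmul_eq_zero h4)
      (addOrderOf_dvd_natCard w)
  rw [hw, sub_eq_zero] at h5
  exact h5

end Actions

/-- The inductive hypothesis for the bound lemma. -/
def BoundFor (n : ℕ) : Prop :=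
  ∀ (A : Type u) (V : Type v) [Group A] [Finite A] [Group.IsNilpotent A] [AddCommGroup V]
    [Finite V] [Nontrivial V] (ρ : A →* AddMonoid.End V),
    (Nat.card A).Coprime (Nat.card V) → Nat.card A + Nat.card V < n →
    (commutator A ⊔ ρ.ker).index < Nat.card V

section IH
variable {Γ : Type u} [Group Γ] [Finite Γ] [Group.IsNilpotent Γ] {V : Type v} [AddCommGroup V]
  [Finite V]

theorem IH1 {n : ℕ} (hn : BoundFor.{u,v} n) (ρ : Γ →* AddMonoid.End V)
    (hco : (Nat.card Γ).Coprime (Nat.card V)) (U : AddSubgroup V) (hU : Inv ρ U) (hU0 : U ≠ ⊥)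
    (hc : Nat.card Γ + Nat.card U < n) :
    (commutator Γ ⊔ fix ρ U).index < Nat.card U := by
  have : Nontrivial U := (AddSubgroup.nontrivial_iff_ne_bot U).2 hU0
  rw [← restr_ker ρ U hU]
  exact hn Γ U (restr ρ U hU) (hco.coprime_dvd_right (AddSubgroup.card_addSubgroup_dvd_card U)) hc

theorem IH2 {n : ℕ} (hn : BoundFor.{u,v} n) (ρ : Γ →* AddMonoid.End V)
    (hinj : Function.Injective ρ)
    (hco : (Nat.card Γ).Coprime (Nat.card V)) (D : Subgroup Γ) (W : AddSubgroup V) (hW : W ≠ ⊤)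
    (hD : D ≤ fix ρ W) (hc : Nat.card D + W.index < n) :
    (⁅D, D⁆).relIndex D < W.index := by
  have hinv : Inv (ρ.comp D.subtype) W := by
    intro a v hv
    have : ρ a v = v := hD a.2 v hv
    simpa [this] using hv
  have : Nontrivial (V ⧸ W) := by
    rw [← not_subsingleton_iff_nontrivial]
    intro h
    exact hW (QuotientAddGroup.addSubgroup_eq_top_of_subsingleton W h)
  have h := hn D (V ⧸ W) (quo _ W hinv)
    ((hco.coprime_dvd_left (Subgroup.card_subgroup_dvd_card D)).coprime_dvd_right
      (AddSubgroup.card_quotient_dvd_card W)) hc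
  have hk : (quo _ W hinv).ker = ⊥ := by
    rw [eq_bot_iff]
    intro d hd
    rw [MonoidHom.mem_ker] at hd
    have : ρ d = 1 := by
      apply coprime_unip ρ hco d W (hD d.2)
      intro v
      have h2 := congrArg (fun f : AddMonoid.End (V ⧸ W) => f (v : V ⧸ W)) hd
      simp only [quo_mk, AddMonoid.End.coe_one, id] at h2
      rw [← QuotientAddGroup.eq_iff_sub_mem]
      exact h2
    rw [Subgroup.mem_bot]
    apply Subtype.ext
    apply hinj
    rw [this]; simp
  rw [hk, sup_bot_eq] at h
  rw [relIndex_comm_self]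
  exact h

end IH
end WT


namespace WT
open Subgroup
open scoped commutatorElement
universe u v

section MinInv
variable {A : Type u} [Group A] {V : Type v} [AddCommGroup V]

/-- minimal invariant additive subgroup -/
def MinInv (ρ : A →* AddMonoid.End V) (U : AddSubgroup V) : Prop :=
  U ≠ ⊥ ∧ Inv ρ U ∧ ∀ W ≤ U, W ≠ ⊥ → Inv ρ W → W = U

theorem Inv.inf {ρ : A →* AddMonoid.End V} {U W : AddSubgroup V} (hU : Inv ρ U) (hW : Inv ρ W) :
    Inv ρ (U ⊓ W) := fun a v hv => ⟨hU a v hv.1, hW a v hv.2⟩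

theorem exists_minInv [Finite V] (ρ : A →* AddMonoid.End V) :
    ∀ (n : ℕ) (U : AddSubgroup V), Nat.card U ≤ n → U ≠ ⊥ → Inv ρ U → ∃ W ≤ U, MinInv ρ W := by
  intro n
  induction n with
  | zero =>
    intro U h
    have : 0 < Nat.card U := Nat.card_pos
    omega
  | succ k ih =>
    intro U hc h0 hU
    by_cases h : ∃ W ≤ U, W ≠ ⊥ ∧ Inv ρ W ∧ W ≠ U
    · obtain ⟨W, hWU, hW0, hW, hne⟩ := h
      have hlt : Nat.card W < Nat.card U := by
        by_contra hh
        exact hne (AddSubgroup.eq_of_le_of_card_ge hWU (not_lt.1 hh))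
      obtain ⟨X, hX, hX'⟩ := ih W (by omega) hW0 hW
      exact ⟨X, hX.trans hWU, hX'⟩
    · push Not at h
      exact ⟨U, le_rfl, h0, hU, h⟩

theorem MinInv.le_or_disj {ρ : A →* AddMonoid.End V} {U W : AddSubgroup V} (hU : MinInv ρ U)
    (hW : Inv ρ W) : U ≤ W ∨ U ⊓ W = ⊥ := by
  by_cases h : U ⊓ W = ⊥
  · exact Or.inr h
  · left
    have := hU.2.2 (U ⊓ W) inf_le_left h (hU.2.1.inf hW)
    rw [← this]; exact inf_le_right

theorem MinInv.eq_or_disj {ρ : A →* AddMonoid.End V} {U W : AddSubgroup V} (hU : MinInv ρ U)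
    (hW : MinInv ρ W) : U = W ∨ U ⊓ W = ⊥ := by
  rcases hU.le_or_disj hW.2.1 with h | h
  · exact Or.inl (hW.2.2 U h hU.1 hU.2.1)
  · exact Or.inr h

/-- translate of an additive subgroup -/
def tr (ρ : A →* AddMonoid.End V) (g : A) (U : AddSubgroup V) : AddSubgroup V where
  carrier := {v | ρ g⁻¹ v ∈ U}
  zero_mem' := by simp
  add_mem' := by
    intro a b ha hb
    simp only [Set.mem_ofPred_eq, map_add] at *
    exact U.add_mem ha hb
  neg_mem' := by
    intro a ha
    simp only [Set.mem_ofPred_eq, map_neg] at *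
    exact U.neg_mem ha

theorem mem_tr {ρ : A →* AddMonoid.End V} {g : A} {U : AddSubgroup V} {v : V} :
    v ∈ tr ρ g U ↔ ρ g⁻¹ v ∈ U := Iff.rfl

theorem tr_apply_mem {ρ : A →* AddMonoid.End V} {g : A} {U : AddSubgroup V} {v : V} (hv : v ∈ U) :
    ρ g v ∈ tr ρ g U := by rw [mem_tr, rho_inv_self]; exact hv

theorem tr_mul (ρ : A →* AddMonoid.End V) (g h : A) (U : AddSubgroup V) :
    tr ρ (g * h) U = tr ρ g (tr ρ h U) := by
  ext v
  rw [mem_tr, mem_tr, mem_tr, mul_inv_rev, rho_mul]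

theorem tr_one (ρ : A →* AddMonoid.End V) (U : AddSubgroup V) : tr ρ 1 U = U := by
  ext v
  rw [mem_tr, inv_one, map_one]; rfl

theorem tr_mono {ρ : A →* AddMonoid.End V} {g : A} {U W : AddSubgroup V} (h : U ≤ W) :
    tr ρ g U ≤ tr ρ g W := fun _ hv => h hv

theorem tr_inv_tr (ρ : A →* AddMonoid.End V) (g : A) (U : AddSubgroup V) :
    tr ρ g⁻¹ (tr ρ g U) = U := by rw [← tr_mul, inv_mul_cancel, tr_one]

theorem tr_tr_inv (ρ : A →* AddMonoid.End V) (g : A) (U : AddSubgroup V) :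
    tr ρ g (tr ρ g⁻¹ U) = U := by rw [← tr_mul, mul_inv_cancel, tr_one]

theorem tr_ne_bot {ρ : A →* AddMonoid.End V} {g : A} {U : AddSubgroup V} (h : U ≠ ⊥) :
    tr ρ g U ≠ ⊥ := by
  obtain ⟨x, hx, h0⟩ := (AddSubgroup.bot_or_exists_ne_zero U).resolve_left h
  intro hb
  have : ρ g x ∈ tr ρ g U := tr_apply_mem hx
  rw [hb, AddSubgroup.mem_bot] at this
  apply h0
  apply rho_inj ρ g
  rw [this, map_zero]

theorem Inv.tr_eq {ρ : A →* AddMonoid.End V} {U : AddSubgroup V} (h : Inv ρ U) (g : A) :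
    tr ρ g U = U := by
  ext v
  rw [mem_tr]
  constructor
  · intro hv
    have := h g _ hv
    rwa [rho_self_inv] at this
  · exact h _ _

theorem inv_of_tr_le {ρ : A →* AddMonoid.End V} {U : AddSubgroup V} (h : ∀ g, tr ρ g U ≤ U) :
    Inv ρ U := fun a _ hv => h a (tr_apply_mem hv)

theorem card_tr (ρ : A →* AddMonoid.End V) (g : A) (U : AddSubgroup V) :
    Nat.card (tr ρ g U) = Nat.card U := by
  apply Nat.card_congr
  exact
  { toFun := fun v => ⟨ρ g⁻¹ v, v.2⟩
    invFun := fun v => ⟨ρ g v, tr_apply_mem v.2⟩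
    left_inv := fun v => Subtype.ext (by simp)
    right_inv := fun v => Subtype.ext (by simp) }

theorem Inv.tr {ρ : A →* AddMonoid.End V} {S : Subgroup A} [S.Normal] {U : AddSubgroup V}
    (h : Inv (ρ.comp S.subtype) U) (g : A) : Inv (ρ.comp S.subtype) (tr ρ g U) := by
  intro s v hv
  rw [mem_tr] at hv ⊢
  have := h ⟨g⁻¹ * s * g⁻¹⁻¹, Subgroup.Normal.conj_mem ‹_› _ s.2 g⁻¹⟩ _ hv
  simpa [rho_mul] using this

theorem MinInv.tr {ρ : A →* AddMonoid.End V} {S : Subgroup A} [S.Normal] {U : AddSubgroup V}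
    (h : MinInv (ρ.comp S.subtype) U) (g : A) : MinInv (ρ.comp S.subtype) (tr ρ g U) := by
  refine ⟨tr_ne_bot h.1, h.2.1.tr g, ?_⟩
  intro W hW h0 hI
  have := h.2.2 (WT.tr ρ g⁻¹ W) (by rw [← tr_inv_tr ρ g U]; exact tr_mono hW) (tr_ne_bot h0) (hI.tr g⁻¹)
  rw [← this, tr_tr_inv]

/-- fixed points -/
def fixedBy (ρ : A →* AddMonoid.End V) (S : Subgroup A) : AddSubgroup V where
  carrier := {v | ∀ a ∈ S, ρ a v = v}
  zero_mem' := by intro a _; simp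
  add_mem' := by
    intro a b ha hb s hs
    rw [map_add, ha s hs, hb s hs]
  neg_mem' := by
    intro a ha s hs
    rw [map_neg, ha s hs]

theorem mem_fixedBy {ρ : A →* AddMonoid.End V} {S : Subgroup A} {v : V} :
    v ∈ fixedBy ρ S ↔ ∀ a ∈ S, ρ a v = v := Iff.rfl

theorem le_fixedBy_iff {ρ : A →* AddMonoid.End V} {S : Subgroup A} {U : AddSubgroup V} :
    U ≤ fixedBy ρ S ↔ S ≤ fix ρ U :=
  ⟨fun h a ha v hv => h hv a ha, fun h _ hv _ ha => h ha _ hv⟩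

theorem fixedBy_inv {ρ : A →* AddMonoid.End V} {S : Subgroup A} [S.Normal] :
    Inv ρ (fixedBy ρ S) := by
  intro g v hv a ha
  have := hv (g⁻¹ * a * g⁻¹⁻¹) (Subgroup.Normal.conj_mem ‹_› _ ha g⁻¹)
  have h2 := congrArg (ρ g) this
  simpa [rho_mul] using h2

theorem fix_top {ρ : A →* AddMonoid.End V} (hinj : Function.Injective ρ) : fix ρ ⊤ = ⊥ := by
  rw [eq_bot_iff]
  intro a ha
  rw [Subgroup.mem_bot]
  apply hinj
  rw [map_one]
  apply AddMonoidHom.ext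
  intro v
  exact ha v trivial

theorem card_mul_le_of_disj [Finite V] {U U' W : AddSubgroup V} (h : U ≤ W) (h' : U' ≤ W)
    (hd : U ⊓ U' = ⊥) : Nat.card U * Nat.card U' ≤ Nat.card W := by
  rw [← Nat.card_prod]
  apply Nat.card_le_card_of_injective
    (fun x : U × U' => (⟨x.1 + x.2, W.add_mem (h x.1.2) (h' x.2.2)⟩ : W))
  intro x y hxy
  have h1 : (x.1 : V) + x.2 = y.1 + y.2 := congrArg Subtype.val hxy
  have h2 : (x.1 : V) - y.1 = y.2 - x.2 := by
    rw [sub_eq_sub_iff_add_eq_add, h1, add_comm]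
  have h3 : (x.1 : V) - y.1 ∈ U ⊓ U' :=
    ⟨U.sub_mem x.1.2 y.1.2, by rw [h2]; exact U'.sub_mem y.2.2 x.2.2⟩
  rw [hd, AddSubgroup.mem_bot] at h3
  have h4 : (y.2 : V) - x.2 = 0 := by rw [← h2, h3]
  exact Prod.ext (Subtype.ext (sub_eq_zero.1 h3)) (Subtype.ext (sub_eq_zero.1 h4).symm)

theorem index_lt_card [Finite V] (ρ : A →* AddMonoid.End V) (D : Subgroup A) (U : AddSubgroup V)
    (hU : Inv ρ U) (x : V) (hx : x ∈ U) (h0 : x ≠ 0) (h : ∀ c, ρ c x = x → c ∈ D) :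
    D.index < Nat.card U := by
  let f : Option (A ⧸ D) → U := fun o => match o with
    | none => 0
    | some q => ⟨ρ q.out x, hU _ _ hx⟩
  have hf : Function.Injective f := by
    rintro (_ | q) (_ | r) hqr
    · rfl
    · exfalso
      have h1 : (0 : V) = ρ r.out x := congrArg Subtype.val hqr
      exact h0 (rho_inj ρ r.out (by rw [← h1, map_zero]))
    · exfalso
      have h1 : ρ q.out x = (0 : V) := congrArg Subtype.val hqr
      exact h0 (rho_inj ρ q.out (by rw [h1, map_zero]))
    · have h1 : ρ q.out x = ρ r.out x := congrArg Subtype.val hqr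
      have h2 := h (q.out⁻¹ * r.out) (by rw [rho_mul, ← h1, rho_inv_self])
      rw [← QuotientGroup.eq] at h2
      simp only [QuotientGroup.out_eq'] at h2
      rw [h2]
  have : Finite (Option (A ⧸ D)) := Finite.of_injective f hf
  have hfin : Finite (A ⧸ D) := Finite.of_injective some (Option.some_injective _)
  have := Nat.card_le_card_of_injective f hf
  rw [Finite.card_option] at this
  exact this

end MinInv

theorem three_sub {Γ : Type*} [Group Γ] (K : Subgroup Γ) [K.Normal] :
    ⁅K, commutator Γ⁆ ≤ ⁅⁅K, (⊤ : Subgroup Γ)⁆, (⊤ : Subgroup Γ)⁆ := by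
  set N := ⁅⁅K, (⊤ : Subgroup Γ)⁆, (⊤ : Subgroup Γ)⁆ with hN
  set π := QuotientGroup.mk' N with hπ
  have hs : Function.Surjective π := QuotientGroup.mk'_surjective N
  have h0 : (⁅⁅K, (⊤ : Subgroup Γ)⁆, (⊤ : Subgroup Γ)⁆).map π = ⊥ := QuotientGroup.map_mk'_self N
  rw [Subgroup.map_commutator, Subgroup.map_commutator,
    Subgroup.map_top_of_surjective _ hs] at h0
  have h1 : ⁅⁅(⊤ : Subgroup (Γ ⧸ N)), (⊤ : Subgroup (Γ ⧸ N))⁆, K.map π⁆ = ⊥ := by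
    apply Subgroup.commutator_commutator_eq_bot_of_rotate
    · rw [Subgroup.commutator_comm ⊤ (K.map π)]; exact h0
    · exact h0
  have h2 : (⁅K, commutator Γ⁆).map π = ⊥ := by
    rw [Subgroup.map_commutator, commutator_def, Subgroup.map_commutator,
      Subgroup.map_top_of_surjective _ hs]
    exact (Subgroup.commutator_comm _ _).trans h1
  rw [Subgroup.map_eq_bot_iff, hπ, QuotientGroup.ker_mk'] at h2
  exact h2

theorem comm_sup_le {Γ : Type*} [Group Γ] (K C D : Subgroup Γ) [C.Normal] :
    ⁅K, C ⊔ D⁆ ≤ C ⊔ ⁅K, D⁆ := by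
  rw [Subgroup.commutator_le]
  intro k hk x hx
  obtain ⟨c, hc, d, hd, rfl⟩ := Subgroup.mem_sup_of_normal_left.1 hx
  have e : ⁅k, c * d⁆ = (k * c * k⁻¹) * (⁅k, d⁆ * c⁻¹ * ⁅k, d⁆⁻¹) * ⁅k, d⁆ := by
    simp only [commutatorElement_def]; group
  rw [e]
  apply Subgroup.mul_mem_sup
  · apply mul_mem
    · exact ‹C.Normal›.conj_mem _ hc _
    · exact ‹C.Normal›.conj_mem _ (inv_mem hc) _
  · exact Subgroup.commutator_mem_commutator hk hd

end WT


namespace WT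
open Subgroup
open scoped commutatorElement
universe u v

/-- a central subgroup irreducible on U forces commutativity on U -/
theorem comm_le_fix_of_central {Γ : Type u} [Group Γ] {V : Type v} [AddCommGroup V]
    (ρ : Γ →* AddMonoid.End V) (C : Subgroup Γ) (hC : C ≤ center Γ) (U : AddSubgroup V)
    (hU : MinInv (ρ.comp C.subtype) U) (hUI : Inv ρ U) : commutator Γ ≤ fix ρ U := by
  set T : Subring (AddMonoid.End V) := Subring.closure (ρ '' C) with hT
  have h1 : T ≤ Subring.centralizer (Set.range ρ) := by
    rw [hT, Subring.closure_le]
    rintro _ ⟨c, hc, rfl⟩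
    rw [SetLike.mem_coe, Subring.mem_centralizer_iff]
    rintro _ ⟨x, rfl⟩
    rw [← map_mul, ← map_mul, Subgroup.mem_center_iff.1 (hC hc) x]
  have h2 : ∀ t ∈ T, ∀ x, ρ x * t = t * ρ x := fun t ht x =>
    Subring.mem_centralizer_iff.1 (h1 ht) _ ⟨x, rfl⟩
  have h3 : T ≤ Subring.centralizer (T : Set (AddMonoid.End V)) := by
    conv_lhs => rw [hT]
    rw [Subring.closure_le]
    rintro _ ⟨c, hc, rfl⟩
    rw [SetLike.mem_coe, Subring.mem_centralizer_iff]
    intro t ht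
    exact (h2 t ht c).symm
  have h4 : ∀ s ∈ T, ∀ t ∈ T, s * t = t * s := fun s hs t ht =>
    Subring.mem_centralizer_iff.1 (h3 ht) s hs
  have hUT : ∀ t ∈ T, ∀ v ∈ U, t v ∈ U := by
    intro t ht
    induction ht using Subring.closure_induction with
    | mem x hx => obtain ⟨c, hc, rfl⟩ := hx; exact hUI c
    | zero => intro v _; exact U.zero_mem
    | one => intro v hv; exact hv
    | add x y _ _ hx hy => intro v hv; exact U.add_mem (hx v hv) (hy v hv)
    | neg x _ hx => intro v hv; exact U.neg_mem (hx v hv)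
    | mul x y _ _ hx hy => intro v hv; exact hx _ (hy v hv)
  have key : ∀ w ∈ U, w ≠ 0 → ∀ z ∈ U, ∃ t ∈ T, t w = z := by
    intro w hw hw0 z hz
    let ev : AddMonoid.End V →+ V :=
      { toFun := fun f => f w, map_zero' := rfl, map_add' := fun _ _ => rfl }
    set W := T.toAddSubgroup.map ev with hW
    have hWU : W ≤ U := by
      rintro _ ⟨t, ht, rfl⟩
      exact hUT t ht w hw
    have : W = U := by
      apply hU.2.2 W hWU
      · intro hb
        have : w ∈ W := ⟨1, T.one_mem, rfl⟩
        rw [hb, AddSubgroup.mem_bot] at this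
        exact hw0 this
      · rintro c _ ⟨t, ht, rfl⟩
        exact ⟨ρ c * t, T.mul_mem (Subring.subset_closure ⟨c, c.2, rfl⟩) ht, rfl⟩
    rw [← this] at hz
    obtain ⟨t, ht, h⟩ := hz
    exact ⟨t, ht, h⟩
  have hxy : ∀ x y, ∀ w ∈ U, ρ x (ρ y w) = ρ y (ρ x w) := by
    intro x y w hw
    by_cases hw0 : w = 0
    · rw [hw0]; simp
    obtain ⟨t, ht, htx⟩ := key w hw hw0 _ (hUI x w hw)
    obtain ⟨s, hs, hsy⟩ := key w hw hw0 _ (hUI y w hw)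
    calc ρ x (ρ y w) = (ρ x * s) w := by rw [← hsy]; rfl
      _ = s (ρ x w) := by rw [h2 s hs]; rfl
      _ = (s * t) w := by rw [← htx]; rfl
      _ = t (s w) := by rw [h4 s hs t ht]; rfl
      _ = (t * ρ y) w := by rw [hsy]; rfl
      _ = ρ y (t w) := by rw [← h2 t ht]; rfl
      _ = _ := by rw [htx]
  rw [commutator_def, Subgroup.commutator_le]
  intro x _ y _ v hv
  have : ⁅x, y⁆ = x * y * x⁻¹ * y⁻¹ := commutatorElement_def x y
  rw [this, rho_mul, rho_mul, rho_mul, hxy x y _ (hUI _ _ (hUI _ _ hv))]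
  simp

theorem core {Γ : Type u} [Group Γ] [Finite Γ] [Group.IsNilpotent Γ] {V : Type v} [AddCommGroup V]
    [Finite V] {n : ℕ} (hn : BoundFor.{u,v} n) (ρ : Γ →* AddMonoid.End V)
    (hinj : Function.Injective ρ) (hco : (Nat.card Γ).Coprime (Nat.card V))
    (hc : Nat.card Γ + Nat.card V < n) {ι : Type*} (W : ι → AddSubgroup V) (i0 : ι) (m : ℕ)
    (hmin : ∀ i, MinInv ρ (W i)) (hm : ∀ i, Nat.card (W i) = m) (htop : ⨆ i, W i = ⊤)
    (hC : ∀ i, fix ρ (W i0) ≤ fix ρ (W i) ⊔ commutator Γ) {p : ℕ} (hp : p.Prime)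
    (hP : IsPGroup p (fix ρ (W i0))) (hne : fix ρ (W i0) ≠ ⊥) :
    p * (commutator Γ).index < Nat.card V := by
  have : Fact p.Prime := ⟨hp⟩
  set C1 := fix ρ (W i0) with hC1
  have hnorm : ∀ i, (fix ρ (W i)).Normal := fun i => fix_normal (hmin i).2.1
  have hC1n : C1.Normal := hnorm i0
  have hleV : ∀ U : AddSubgroup V, Nat.card U ≤ Nat.card V := fun U =>
    AddSubgroup.card_le_card_addGroup U
  have hleΓ : ∀ D : Subgroup Γ, Nat.card D ≤ Nat.card Γ := fun U =>
    Subgroup.card_le_card_group U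
  have hidx : ∀ U : AddSubgroup V, U.index ≤ Nat.card V := fun U =>
    Nat.le_of_dvd Nat.card_pos (AddSubgroup.card_quotient_dvd_card U)
  have hfixall : ∀ g : Γ, (∀ i, g ∈ fix ρ (W i)) → g = 1 := by
    intro g hg
    have h1 : (⊤ : AddSubgroup V) ≤ fixedBy ρ (Subgroup.zpowers g) := by
      rw [← htop, iSup_le_iff]
      intro i
      rw [le_fixedBy_iff, Subgroup.zpowers_le]
      exact hg i
    rw [le_fixedBy_iff, fix_top hinj, Subgroup.zpowers_le, Subgroup.mem_bot] at h1
    exact h1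
  have ha := IH1 hn ρ hco (W i0) (hmin i0).2.1 (hmin i0).1 (by have := hleV (W i0); omega)
  rw [hm] at ha
  have hW0 : W i0 ≠ ⊤ := by
    intro h
    apply hne
    rw [hC1, h, fix_top hinj]
  have hb := IH2 hn ρ hinj hco C1 (W i0) hW0 le_rfl
    (by have := hleΓ C1; have := hidx (W i0); omega)
  have hV1 : m * (W i0).index = Nat.card V := by
    rw [← hm i0]; exact AddSubgroup.card_mul_index _
  have hform := index_sup_formula C1
  set a := (commutator Γ ⊔ C1).index with ha'
  have hlei : ⁅C1, C1⁆ ≤ C1 ⊓ commutator Γ :=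
    le_inf (Subgroup.commutator_le_left C1 C1) (comm_le_commutator C1)
  -- p-power indices
  have hpp : ∀ D E : Subgroup Γ, E ≤ C1 → ¬ E ≤ D → p ≤ D.relIndex E := by
    intro D E hE hD
    have h1 : D.relIndex E ≠ 1 := fun h => hD (Subgroup.relIndex_eq_one.1 h)
    obtain ⟨k, hk⟩ := (hP.to_le hE).index (D.subgroupOf E)
    rw [← Subgroup.relIndex] at hk
    rcases Nat.eq_zero_or_pos k with h | h
    · rw [h, pow_zero] at hk; exact absurd hk h1
    · rw [hk]; exact Nat.le_self_pow h.ne' p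
  by_cases hcase : C1 ⊓ commutator Γ ≤ ⁅C1, C1⁆
  · -- case (c)
    have hX : ⁅C1, (⊤ : Subgroup Γ)⁆ ≤ ⁅C1, C1⁆ := by
      refine le_trans (le_inf (Subgroup.commutator_le_left _ _) ?_) hcase
      exact Subgroup.commutator_mono le_top le_rfl
    have hXi : ∀ i, ⁅C1, (⊤ : Subgroup Γ)⁆ ≤ fix ρ (W i) := by
      intro i
      have := hnorm i
      apply nilp_sup
      calc ⁅C1, (⊤ : Subgroup Γ)⁆ ≤ ⁅C1, C1⁆ := hX
        _ ≤ ⁅C1, fix ρ (W i) ⊔ commutator Γ⁆ := Subgroup.commutator_mono le_rfl (hC i)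
        _ ≤ fix ρ (W i) ⊔ ⁅C1, commutator Γ⁆ := comm_sup_le _ _ _
        _ ≤ _ := sup_le_sup le_rfl (three_sub C1)
    have hcb : ⁅C1, (⊤ : Subgroup Γ)⁆ = ⊥ := by
      rw [eq_bot_iff]
      intro g hg
      rw [Subgroup.mem_bot]
      exact hfixall g (fun i => hXi i hg)
    have hcen : C1 ≤ center Γ := Subgroup.commutator_top_right_eq_bot_iff_le_center.1 hcb
    have hC1' : ⁅C1, C1⁆ = ⊥ := by
      rw [eq_bot_iff, ← hcb]; exact Subgroup.commutator_mono le_rfl le_top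
    have hrel : (commutator Γ).relIndex C1 = Nat.card C1 := by
      rw [← Subgroup.inf_relIndex_left, ← Subgroup.relIndex_bot_left]
      congr 1
      rw [eq_bot_iff, ← hC1']; exact hcase
    obtain ⟨i, hi⟩ : ∃ i, ¬ C1 ≤ fix ρ (W i) := by
      by_contra! h
      apply hne
      rw [eq_bot_iff]
      intro g hg
      rw [Subgroup.mem_bot]
      exact hfixall g (fun i => h i hg)
    have hΓi : ¬ commutator Γ ≤ fix ρ (W i) := by
      intro h
      apply hi
      exact (hC i).trans (sup_le le_rfl h)
    have hWne : W i0 ≠ W i := by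
      intro h; apply hi; rw [← h]
    have hdisj := ((hmin i0).eq_or_disj (hmin i)).resolve_left hWne
    have hmV : m * m ≤ Nat.card (W i0 ⊔ W i : AddSubgroup V) := by
      have := card_mul_le_of_disj (le_sup_left : W i0 ≤ W i0 ⊔ W i) le_sup_right hdisj
      rwa [hm, hm] at this
    have hsemi : ∀ z ∈ C1, z ∉ fix ρ (W i) → ∀ v ∈ W i, ρ z v = v → v = 0 := by
      intro z hz hzi v hv hzv
      have hzn : (Subgroup.zpowers z).Normal := by
        constructor
        intro x hx g
        have : x ∈ center Γ := (Subgroup.zpowers_le.2 (hcen hz)) hx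
        rw [Subgroup.mem_center_iff.1 this g]; simpa using hx
      rcases (hmin i).le_or_disj (fixedBy_inv (ρ := ρ) (S := Subgroup.zpowers z)) with h | h
      · exfalso; apply hzi
        rw [le_fixedBy_iff, Subgroup.zpowers_le] at h
        exact h
      · have : v ∈ W i ⊓ fixedBy ρ (Subgroup.zpowers z) := by
          refine ⟨hv, ?_⟩
          have : AddSubgroup.zmultiples v ≤ fixedBy ρ (Subgroup.zpowers z) := by
            rw [le_fixedBy_iff, Subgroup.zpowers_le]
            intro w hw
            obtain ⟨j, rfl⟩ := AddSubgroup.mem_zmultiples_iff.1 hw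
            rw [map_zsmul, hzv]
          exact this (AddSubgroup.mem_zmultiples v)
        rw [h, AddSubgroup.mem_bot] at this
        exact this
    have hInvC : Inv (ρ.comp C1.subtype) (W i) := fun c v hv => (hmin i).2.1 c v hv
    obtain ⟨U, hUW, hU⟩ := exists_minInv (ρ.comp C1.subtype) _ (W i) le_rfl (hmin i).1 hInvC
    obtain ⟨w, hw, hw0⟩ := (AddSubgroup.bot_or_exists_ne_zero U).resolve_left hU.1
    have hk1 : (fix ρ (W i)).relIndex C1 < Nat.card U := by
      apply index_lt_card (ρ.comp C1.subtype) _ U hU.2.1 w hw hw0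
      intro c hcw
      rw [Subgroup.mem_subgroupOf]
      by_contra h
      exact hw0 (hsemi c c.2 h w (hUW hw) hcw)
    have hk2 : p ≤ (fix ρ (W i)).relIndex C1 := hpp _ _ le_rfl hi
    have hUW' : U ≠ W i := by
      intro h
      apply hΓi
      rw [← h]
      exact comm_le_fix_of_central ρ C1 hcen U hU (h ▸ (hmin i).2.1)
    obtain ⟨x, hx⟩ : ∃ x, tr ρ x U ≠ U := by
      by_contra! h
      exact hUW' ((hmin i).2.2 U hUW hU.1 (inv_of_tr_le fun g => (h g).le))
    have hxU : U ⊓ tr ρ x U = ⊥ := (hU.eq_or_disj (hU.tr x)).resolve_left hx.symm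
    have hUU : Nat.card U * Nat.card U ≤ m := by
      have h1 : tr ρ x U ≤ W i := by
        rw [← (hmin i).2.1.tr_eq x]; exact tr_mono hUW
      have := card_mul_le_of_disj hUW h1 hxU
      rwa [card_tr, hm] at this
    set D := C1 ⊓ fix ρ (W i) with hD
    have hDfix : D ≤ fix ρ (W i0 ⊔ W i) := by
      rw [← le_fixedBy_iff]
      exact sup_le (le_fixedBy_iff.2 inf_le_left) (le_fixedBy_iff.2 inf_le_right)
    have hDD : ⁅D, D⁆ = ⊥ := by
      rw [eq_bot_iff, ← hC1']; exact Subgroup.commutator_mono inf_le_left inf_le_left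
    have hDc : Nat.card D ≤ (W i0 ⊔ W i).index := by
      by_cases ht : W i0 ⊔ W i = ⊤
      · rw [ht, fix_top hinj] at hDfix
        rw [le_bot_iff.1 hDfix, ht]; simp
      · have := IH2 hn ρ hinj hco D _ ht hDfix
          (by have := hleΓ D; have := hidx (W i0 ⊔ W i); omega)
        rw [hDD, Subgroup.relIndex_bot_left] at this
        exact this.le
    have hcC : Nat.card C1 = Nat.card D * (fix ρ (W i)).relIndex C1 := by
      rw [← Subgroup.relIndex_bot_left (H := C1),
        ← Subgroup.relIndex_mul_relIndex ⊥ D C1 bot_le inf_le_left, Subgroup.relIndex_bot_left,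
        hD, Subgroup.inf_relIndex_left]
    have hVV : Nat.card (W i0 ⊔ W i : AddSubgroup V) * (W i0 ⊔ W i).index = Nat.card V :=
      AddSubgroup.card_mul_index _
    have hipos : 0 < (W i0 ⊔ W i).index := by
      apply Nat.pos_of_ne_zero
      exact AddSubgroup.index_ne_zero_of_finite
    rw [hform, hrel, hcC]
    set k := (fix ρ (W i)).relIndex C1
    set r := Nat.card U
    set t := (W i0 ⊔ W i).index
    have e1 : p * k ≤ m - 1 := by
      have : p * k ≤ k * k := Nat.mul_le_mul_right k hk2
      have h2 : k * k < r * r := Nat.mul_lt_mul'' hk1 hk1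
      omega
    calc p * (a * (Nat.card D * k)) = a * (p * k) * Nat.card D := by ring
      _ ≤ (m - 1) * (m - 1) * t := by gcongr; omega
      _ < m * m * t := by
        apply Nat.mul_lt_mul_of_pos_right _ hipos
        apply Nat.mul_lt_mul'' <;> omega
      _ ≤ Nat.card V := by rw [← hVV]; gcongr
  · have h1 : p ≤ (⁅C1, C1⁆).relIndex (C1 ⊓ commutator Γ) := hpp _ _ inf_le_left hcase
    have h2 := Subgroup.relIndex_mul_relIndex _ _ C1 hlei inf_le_left
    rw [Subgroup.inf_relIndex_left] at h2
    rw [hform]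
    have hpos : 0 < m := by omega
    calc p * (a * (commutator Γ).relIndex C1)
        ≤ (⁅C1, C1⁆).relIndex (C1 ⊓ commutator Γ) * (a * (commutator Γ).relIndex C1) := by gcongr
      _ = a * (⁅C1, C1⁆).relIndex C1 := by rw [← h2]; ring
      _ ≤ m * (⁅C1, C1⁆).relIndex C1 := by gcongr
      _ < m * (W i0).index := by gcongr
      _ = _ := hV1

end WT


namespace WT
open Subgroup
open scoped commutatorElement
universe u v

theorem coatom_normal {A : Type*} [Group A] [Finite A] [Group.IsNilpotent A] {M : Subgroup A}
    (hM : IsCoatom M) : M.Normal := by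
  have h : ∀ H : Subgroup A, IsCoatom H → H.Normal :=
    ((Group.isNilpotent_of_finite_tfae (G := A)).out 0 2).1 ‹Group.IsNilpotent A›
  exact h M hM

theorem coatom_index_prime {A : Type*} [Group A] [Finite A] {M : Subgroup A} [M.Normal]
    (hM : IsCoatom M) : M.index.Prime := by
  have h1 : Nat.card (A ⧸ M) ≠ 1 := fun h => hM.1 (Subgroup.index_eq_one.1 h)
  obtain ⟨q, hq, hqd⟩ := Nat.exists_prime_and_dvd h1
  have : Fact q.Prime := ⟨hq⟩
  obtain ⟨x, hx⟩ := exists_prime_orderOf_dvd_card' q hqd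
  have h2 : (Subgroup.zpowers x).comap (QuotientGroup.mk' M) = ⊤ := by
    rcases hM.le_iff.1 (QuotientGroup.le_comap_mk' M (Subgroup.zpowers x)) with h | h
    · exact h
    · exfalso
      obtain ⟨g, rfl⟩ := QuotientGroup.mk'_surjective M x
      have : g ∈ M := by rw [← h]; exact Subgroup.mem_zpowers _
      rw [← QuotientGroup.eq_one_iff] at this
      rw [QuotientGroup.mk'_apply, this, orderOf_one] at hx
      exact hq.one_lt.ne hx
  have h3 : Subgroup.zpowers x = ⊤ := by
    rw [← Subgroup.map_comap_eq_self_of_surjective (QuotientGroup.mk'_surjective M) (zpowers x), h2,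
      Subgroup.map_top_of_surjective _ (QuotientGroup.mk'_surjective M)]
  have h4 : Nat.card (A ⧸ M) = q := by
    rw [← hx, ← Nat.card_zpowers, h3, Subgroup.card_top]
  rw [Subgroup.index, h4]; exact hq

theorem centralizer_index_le {Q : Type*} [Group Q] [Finite Q] (x : Q) :
    (Subgroup.centralizer {x}).index ≤ Nat.card (commutator Q) := by
  rw [Subgroup.index]
  apply Nat.card_le_card_of_injective
    (fun q : Q ⧸ Subgroup.centralizer {x} =>
      (⟨⁅q.out, x⁆, Subgroup.commutator_mem_commutator trivial trivial⟩ : commutator Q))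
  intro q r h
  have h1 : ⁅q.out, x⁆ = ⁅r.out, x⁆ := congrArg Subtype.val h
  simp only [commutatorElement_def, mul_left_inj] at h1
  have h2 : q.out⁻¹ * r.out ∈ Subgroup.centralizer {x} := by
    rw [Subgroup.mem_centralizer_singleton_iff]
    generalize q.out = a at *
    generalize r.out = b at *
    calc a⁻¹ * b * x = a⁻¹ * (b * x * b⁻¹) * b := by group
      _ = a⁻¹ * (a * x * a⁻¹) * b := by rw [h1]
      _ = _ := by group
  rw [← QuotientGroup.eq] at h2
  simpa only [QuotientGroup.out_eq'] using h2

theorem card_comm_ge {Q : Type*} [Group Q] [Finite Q] (M : Subgroup Q) (hM : IsCoatom M)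
    (hab : ⁅M, M⁆ = ⊥) (hne : commutator Q ≠ ⊥) : M.index ≤ Nat.card (commutator Q) := by
  have hcomm : ∀ x ∈ M, ∀ y ∈ M, x * y = y * x := by
    intro x hx y hy
    rw [Subgroup.commutator_eq_bot_iff_le_centralizer] at hab
    exact (Subgroup.mem_centralizer_iff.1 (hab hx) y hy).symm
  obtain ⟨x, hx, hxc⟩ : ∃ x ∈ M, x ∉ center Q := by
    by_contra! h
    apply hne
    have hz : M ≤ center Q := h
    obtain ⟨g, hg⟩ : ∃ g, g ∉ M := by
      by_contra! h
      exact hM.1 (eq_top_iff.2 fun x _ => h x)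
    have h1 : center Q = ⊤ := by
      rcases hM.le_iff.1 hz with h1 | h1
      · exact h1
      · exfalso
        apply hg
        rw [← h1]
        have h2 : M ≤ Subgroup.centralizer {g} := fun y hy => by
          rw [Subgroup.mem_centralizer_singleton_iff, Subgroup.mem_center_iff.1 (hz hy) g]
        rcases hM.le_iff.1 h2 with h3 | h3
        · rw [Subgroup.mem_center_iff]
          intro y
          have : y ∈ Subgroup.centralizer {g} := by rw [h3]; trivial
          exact Subgroup.mem_centralizer_singleton_iff.1 this
        · exfalso; apply hg; rw [← h3, Subgroup.mem_centralizer_singleton_iff]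
    rw [commutator_def, Subgroup.commutator_top_right_eq_bot_iff_le_center, h1]
  have h1 : M ≤ Subgroup.centralizer {x} := fun y hy => by
    rw [Subgroup.mem_centralizer_singleton_iff]
    exact hcomm y hy x hx
  rcases hM.le_iff.1 h1 with h2 | h2
  · exfalso; apply hxc
    rw [Subgroup.mem_center_iff]
    intro y
    have : y ∈ Subgroup.centralizer {x} := by rw [h2]; trivial
    exact Subgroup.mem_centralizer_singleton_iff.1 this
  · rw [← h2]; exact centralizer_index_le x

theorem index_le_of_comm_ne {A : Type*} [Group A] [Finite A] (M : Subgroup A) [M.Normal]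
    (hM : IsCoatom M) (hne : ¬ commutator A ≤ ⁅M, M⁆) :
    (commutator A).index ≤ (commutator M).index := by
  set π := QuotientGroup.mk' ⁅M, M⁆ with hπ
  have hs : Function.Surjective π := QuotientGroup.mk'_surjective _
  have hker : π.ker = ⁅M, M⁆ := QuotientGroup.ker_mk' _
  have hkM : π.ker ≤ M := by rw [hker]; exact Subgroup.commutator_le_left M M
  have hkA : π.ker ≤ commutator A := by rw [hker]; exact comm_le_commutator M
  have hcq : commutator (A ⧸ ⁅M, M⁆) = (commutator A).map π := by
    rw [commutator_def, commutator_def, Subgroup.map_commutator,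
      Subgroup.map_top_of_surjective _ hs]
  have hco : IsCoatom (M.map π) := by
    constructor
    · intro h
      apply hM.1
      rw [← Subgroup.comap_map_eq_self hkM, h, Subgroup.comap_top]
    · intro K hK
      have h1 : M < K.comap π := by
        have := (Subgroup.comap_lt_comap_of_surjective hs).2 hK
        rwa [Subgroup.comap_map_eq_self hkM] at this
      have h2 := hM.2 _ h1
      rw [← Subgroup.map_comap_eq_self_of_surjective hs K, h2,
        Subgroup.map_top_of_surjective _ hs]
  have hidx : ∀ K : Subgroup A, π.ker ≤ K → (K.map π).index = K.index := by
    intro K hK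
    rw [← Subgroup.index_comap_of_surjective _ hs, Subgroup.comap_map_eq_self hK]
  have h1 := card_comm_ge (M.map π) hco
    (by rw [← Subgroup.map_commutator, Subgroup.map_eq_bot_iff, hker])
    (by rw [hcq, Ne, Subgroup.map_eq_bot_iff, hker]; exact hne)
  rw [hidx M hkM] at h1
  have h2 : Nat.card (commutator (A ⧸ ⁅M, M⁆)) * (commutator A).index = (⁅M, M⁆).index := by
    rw [← hidx _ hkA, ← hcq, Subgroup.card_mul_index, Subgroup.index]
  have h3 : (⁅M, M⁆).index = (commutator M).index * M.index := by
    rw [← relIndex_comm_self, Subgroup.relIndex_mul_index (Subgroup.commutator_le_left M M)]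
  have h4 : 0 < M.index := Nat.pos_of_ne_zero Subgroup.index_ne_zero_of_finite
  have h5 : M.index * (commutator A).index ≤ M.index * (commutator M).index := by
    calc _ ≤ Nat.card (commutator (A ⧸ ⁅M, M⁆)) * (commutator A).index := by gcongr
      _ = _ := by rw [h2, h3, mul_comm]
  exact Nat.le_of_mul_le_mul_left h5 h4

theorem caseI {A : Type u} [Group A] [Finite A] [Group.IsNilpotent A] {V : Type v} [AddCommGroup V]
    [Finite V] [Nontrivial V] {n : ℕ} (hn : BoundFor.{u,v} n) (ρ : A →* AddMonoid.End V)
    (hinj : Function.Injective ρ) (hco : (Nat.card A).Coprime (Nat.card V))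
    (hc : Nat.card A + Nat.card V ≤ n) (hirr : MinInv ρ ⊤) (M : Subgroup A) (hM : IsCoatom M)
    (V1 : AddSubgroup V) (hV1 : MinInv (ρ.comp M.subtype) V1) (hV1t : V1 ≠ ⊤) :
    (commutator A).index < Nat.card V := by
  have hMn : M.Normal := coatom_normal hM
  have hp := coatom_index_prime hM
  set p := M.index with hpdef
  have hcM : Nat.card M < Nat.card A := by
    by_contra h
    exact hM.1 (Subgroup.eq_top_of_le_card M (not_lt.1 h))
  have hcM' : Nat.card M + Nat.card V < n := by omega
  have hinjM : Function.Injective (ρ.comp M.subtype) := hinj.comp M.subtype_injective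
  have hcoM : (Nat.card M).Coprime (Nat.card V) :=
    hco.coprime_dvd_left (Subgroup.card_subgroup_dvd_card M)
  by_cases hne : commutator A ≤ ⁅M, M⁆
  swap
  · refine (index_le_of_comm_ne M hM hne).trans_lt ?_
    have := hn M V (ρ.comp M.subtype) hcoM hcM'
    rwa [(MonoidHom.ker_eq_bot_iff _).2 hinjM, sup_bot_eq] at this
  have hAM : commutator A = ⁅M, M⁆ := le_antisymm hne (comm_le_commutator M)
  have hidx : (commutator A).index = p * (commutator M).index := by
    rw [hAM, ← Subgroup.relIndex_mul_index (Subgroup.commutator_le_left M M), relIndex_comm_self,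
      mul_comm]
  rw [hidx]
  -- stabilizer of V1
  let S : Subgroup A :=
    { carrier := {g | tr ρ g V1 = V1}
      one_mem' := tr_one ρ V1
      mul_mem' := by
        intro a b ha hb
        rw [Set.mem_ofPred_eq] at *
        rw [tr_mul, hb, ha]
      inv_mem' := by
        intro a ha
        rw [Set.mem_ofPred_eq] at *
        conv_lhs => rw [← ha]
        rw [tr_inv_tr] }
  have hMS' : ∀ y ∈ M, tr ρ y V1 = V1 := fun y hy => hV1.2.1.tr_eq (⟨y, hy⟩ : M)
  have hMS : M ≤ S := fun y hy => hMS' y hy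
  have hS : S = M := by
    rcases hM.le_iff.1 hMS with h | h
    · exfalso
      apply hV1t
      apply hirr.2.2 V1 le_top hV1.1
      apply inv_of_tr_le
      intro g
      have : g ∈ S := by rw [h]; trivial
      exact le_of_eq this
    · exact h
  have hstab : ∀ g, tr ρ g V1 = V1 → g ∈ M := fun g hg => by rw [← hS]; exact hg
  have htop : ⨆ g : A, tr ρ g V1 = ⊤ := by
    apply hirr.2.2 _ le_top
    · intro h
      apply hV1.1
      rw [eq_bot_iff, ← h]
      refine le_trans (le_of_eq (tr_one ρ V1).symm) (le_iSup (fun g => tr ρ g V1) 1)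
    · have key : ∀ a : A, (⨆ g : A, tr ρ g V1) ≤ (⨆ g : A, tr ρ g V1).comap (ρ a) := by
        intro a
        rw [iSup_le_iff]
        intro g v hv
        have h1 : ρ a v ∈ tr ρ (a * g) V1 := by rw [tr_mul]; exact tr_apply_mem hv
        exact (le_iSup (fun g => tr ρ g V1) (a * g)) h1
      exact fun a v hv => key a hv
  by_cases hC1 : fix (ρ.comp M.subtype) V1 = ⊥
  · have h1 := IH1 hn (ρ.comp M.subtype) hcoM V1 hV1.2.1 hV1.1
      (by have := AddSubgroup.card_le_card_addGroup V1; omega)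
    rw [hC1, sup_bot_eq] at h1
    classical
    have hopt1 : Nat.card V1 = Nat.card {w : V1 // w ≠ 0} + 1 := by
      rw [← Finite.card_option]
      exact Nat.card_congr (Equiv.optionSubtypeNe (0 : V1)).symm
    have hopt2 : Nat.card V = Nat.card {w : V // w ≠ 0} + 1 := by
      rw [← Finite.card_option]
      exact Nat.card_congr (Equiv.optionSubtypeNe (0 : V)).symm
    have hle : Nat.card ((A ⧸ M) × {w : V1 // w ≠ 0}) ≤ Nat.card {w : V // w ≠ 0} := by
      apply Nat.card_le_card_of_injective
        (fun x : (A ⧸ M) × {w : V1 // w ≠ 0} => (⟨ρ x.1.out (x.2.1 : V), by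
          intro h
          apply x.2.2
          apply Subtype.ext
          exact rho_inj ρ x.1.out (by rw [h]; simp)⟩ : {w : V // w ≠ 0}))
      rintro ⟨q, w⟩ ⟨r, z⟩ h
      have h1 : ρ q.out (w.1 : V) = ρ r.out (z.1 : V) := congrArg Subtype.val h
      have hw0 : (w.1 : V) ≠ 0 := fun h => w.2 (Subtype.ext h)
      have h2 : tr ρ q.out V1 = tr ρ r.out V1 := by
        rcases (hV1.tr q.out).eq_or_disj (hV1.tr r.out) with h3 | h3
        · exact h3
        · exfalso
          have h4 : ρ q.out (w.1 : V) ∈ tr ρ q.out V1 ⊓ tr ρ r.out V1 :=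
            ⟨tr_apply_mem w.1.2, by rw [h1]; exact tr_apply_mem z.1.2⟩
          rw [h3, AddSubgroup.mem_bot] at h4
          exact hw0 (rho_inj ρ q.out (by rw [h4]; simp))
      have h3 : q.out⁻¹ * r.out ∈ M := by
        apply hstab
        rw [tr_mul, ← h2, tr_inv_tr]
      rw [← QuotientGroup.eq] at h3
      simp only [QuotientGroup.out_eq'] at h3
      subst h3
      have h5 := rho_inj ρ _ h1
      exact Prod.ext rfl (Subtype.ext (Subtype.ext h5))
    rw [Nat.card_prod, ← Subgroup.index, ← hpdef] at hle
    have : p * (commutator M).index ≤ p * Nat.card {w : V1 // w ≠ 0} :=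
      Nat.mul_le_mul_left p (by omega)
    omega
  · apply core hn (ρ.comp M.subtype) hinjM hcoM hcM' (fun g : A => tr ρ g V1) 1 (Nat.card V1)
      (fun g => hV1.tr g) (fun g => card_tr ρ g V1) htop ?_ hp ?_ ?_
    · intro g c hcc
      simp only [tr_one] at hcc
      have e : (c : A) = (g * c * g⁻¹) * ⁅g, (c : A)⁻¹⁆ := by
        rw [commutatorElement_def]; group
      have hm1 : g * c * g⁻¹ ∈ M := hMn.conj_mem _ c.2 g
      have hm2 : ⁅g, (c : A)⁻¹⁆ ∈ ⁅M, M⁆ := by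
        rw [← hAM]; exact Subgroup.commutator_mem_commutator trivial trivial
      have hm3 : ⁅g, (c : A)⁻¹⁆ ∈ M := Subgroup.commutator_le_left M M hm2
      have e' : c = (⟨g * c * g⁻¹, hm1⟩ : M) * ⟨⁅g, (c : A)⁻¹⁆, hm3⟩ := Subtype.ext e
      rw [e']
      apply Subgroup.mul_mem_sup
      · intro v hv
        have h1 : ρ c (ρ g⁻¹ v) = ρ g⁻¹ v := hcc _ hv
        change ρ (g * c * g⁻¹) v = v
        rw [rho_mul, rho_mul, h1, rho_self_inv]
      · rw [← Subgroup.map_subtype_commutator] at hm2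
        obtain ⟨y, hy, hy'⟩ := hm2
        have : (⟨⁅g, (c : A)⁻¹⁆, hm3⟩ : M) = y := Subtype.ext hy'.symm
        rw [this]; exact hy
    · obtain ⟨s, r, hr, hcard⟩ := Nat.exists_eq_pow_mul_and_not_dvd
        (Nat.card_pos (α := A)).ne' p hp.one_lt.ne'
      have hcop : r.Coprime p := ((Nat.Prime.coprime_iff_not_dvd hp).2 hr).symm
      obtain ⟨j, hj⟩ := Nat.exists_mul_mod_eq_one_of_coprime hcop hp.one_lt
      intro c
      refine ⟨s, ?_⟩
      obtain ⟨⟨c, hcM0⟩, hcf⟩ := c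
      apply Subtype.ext
      apply Subtype.ext
      change c ^ (p ^ s) = 1
      set d := c ^ (p ^ s) with hd
      have hdr : d ^ r = 1 := by
        rw [hd, ← pow_mul, ← hcard, pow_card_eq_one']
      have hcV : ∀ v ∈ V1, ρ c v = v := by
        intro v hv
        exact hcf v (by simpa only [tr_one] using hv)
      have hdV : ∀ v ∈ V1, ρ d v = v := by
        have : d ∈ fix ρ V1 := pow_mem (show c ∈ fix ρ V1 from hcV) _
        exact this
      have hfixg : ∀ g : A, d ∈ fix ρ (tr ρ g V1) := by
        intro g
        have hgM : g ^ (p * (r * j / p)) ∈ M := by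
          rw [pow_mul]
          exact pow_mem (Subgroup.pow_index_mem M g) _
        set h := g ^ (r * j) with hh
        have hhg : h = g * g ^ (p * (r * j / p)) := by
          rw [hh, ← pow_succ']
          congr 1
          have := Nat.div_add_mod (r * j) p
          omega
        have htr : tr ρ g V1 = tr ρ h V1 := by
          rw [hhg, tr_mul, hMS' _ hgM]
        have hho : h ^ (p ^ s) = 1 := by
          rw [hh, ← pow_mul, show r * j * p ^ s = p ^ s * r * j by ring, ← hcard, pow_mul,
            pow_card_eq_one', one_pow]
        have hcomm : d * h = h * d := by
          apply nilp_commute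
          exact Nat.Coprime.of_dvd (orderOf_dvd_of_pow_eq_one hdr) (orderOf_dvd_of_pow_eq_one hho)
            (hcop.pow_right s)
        rw [htr]
        intro v hv
        have h1 : v = ρ h (ρ h⁻¹ v) := by simp
        rw [h1, ← rho_mul, hcomm, rho_mul, hdV _ hv]
      have h1 : (⊤ : AddSubgroup V) ≤ fixedBy ρ (Subgroup.zpowers d) := by
        rw [← htop, iSup_le_iff]
        intro g
        rw [le_fixedBy_iff, Subgroup.zpowers_le]
        exact hfixg g
      rw [le_fixedBy_iff, fix_top hinj, Subgroup.zpowers_le, Subgroup.mem_bot] at h1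
      exact h1
    · simpa only [tr_one] using hC1

end WT


namespace WT
open Subgroup
open scoped commutatorElement
universe u v

/-- maximal abelian normal subgroup of a nilpotent group is self-centralizing -/
theorem exists_self_centralizing {A : Type u} [Group A] [Finite A] [Group.IsNilpotent A] :
    ∃ E : Subgroup A, E.Normal ∧ E ≤ Subgroup.centralizer (E : Set A) ∧
      Subgroup.centralizer (E : Set A) ≤ E := by
  obtain ⟨E, -, hE⟩ := Finite.exists_le_maximal (α := Subgroup A) (a := ⊥)
    (p := fun E : Subgroup A => E.Normal ∧ E ≤ Subgroup.centralizer (E : Set A))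
    ⟨inferInstance, bot_le⟩
  refine ⟨E, hE.prop.1, hE.prop.2, ?_⟩
  have hEn := hE.prop.1
  have hEa := hE.prop.2
  set C := Subgroup.centralizer (E : Set A) with hC
  have hCn : C.Normal := inferInstance
  obtain ⟨n, hn⟩ := (‹Group.IsNilpotent A›).nilpotent'
  have key : ∀ k, C ⊓ Subgroup.upperCentralSeries A k ≤ E := by
    intro k
    induction k with
    | zero => rw [Subgroup.upperCentralSeries_zero, inf_bot_eq]; exact bot_le
    | succ k ih =>
      rintro x ⟨hxC, hxZ⟩
      have hx : ∀ g, ⁅x, g⁆ ∈ E := fun g => ih ⟨by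
        rw [commutatorElement_def, mul_assoc, mul_assoc]
        apply mul_mem hxC
        rw [← mul_assoc]
        exact hCn.conj_mem _ (inv_mem hxC) g, Subgroup.mem_upperCentralSeries_succ_iff.1 hxZ g⟩
      set K := Subgroup.zpowers x ⊔ E with hK
      have hEK : E ≤ K := le_sup_right
      have hxK : x ∈ K := (le_sup_left : _ ≤ K) (Subgroup.mem_zpowers x)
      have hKC : K ≤ C := sup_le (Subgroup.zpowers_le.2 hxC) hEa
      have hKx : K ≤ Subgroup.centralizer {x} := by
        refine sup_le (Subgroup.zpowers_le.2 ?_) ?_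
        · rw [Subgroup.mem_centralizer_singleton_iff]
        · intro e he
          rw [Subgroup.mem_centralizer_singleton_iff]
          exact (Subgroup.mem_centralizer_iff.1 hxC e he)
      have hKK : K ≤ Subgroup.centralizer (K : Set A) := by
        refine sup_le (Subgroup.zpowers_le.2 ?_) ?_
        · rw [Subgroup.mem_centralizer_iff]
          intro y hy
          exact Subgroup.mem_centralizer_singleton_iff.1 (hKx hy)
        · intro e he
          rw [Subgroup.mem_centralizer_iff]
          intro y hy
          exact (Subgroup.mem_centralizer_iff.1 (hKC hy) e he).symm
      have hKn : K.Normal := by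
        constructor
        intro y hy g
        have : K ≤ K.comap (MulAut.conj g).toMonoidHom := by
          refine sup_le (Subgroup.zpowers_le.2 ?_) ?_
          · change g * x * g⁻¹ ∈ K
            have e : g * x * g⁻¹ = ⁅x, g⁆⁻¹ * x := by rw [commutatorElement_def]; group
            rw [e]
            exact mul_mem (inv_mem (hEK (hx g))) hxK
          · intro e he
            exact hEK (hEn.conj_mem e he g)
        exact this hy
      exact hE.le_of_ge ⟨hKn, hKK⟩ hEK hxK
  have := key n
  rwa [hn, inf_top_eq] at this

theorem cyclic_of_semireg_aux {E : Type u} [Group E] [Finite E] {V : Type v} [AddCommGroup V]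
    [Finite V] [Nontrivial V] {T : Type v} [CommRing T] (j : T →+* AddMonoid.End V)
    (hj : Function.Injective j) (f : E →* T)
    (hco : (Nat.card E).Coprime (Nat.card V))
    (hs : ∀ e : E, e ≠ 1 → ∀ v, j (f e) v = v → v = 0) : IsCyclic E := by
  have hne : Nontrivial T := by
    refine ⟨⟨0, 1, ?_⟩⟩
    intro h
    obtain ⟨v, hv⟩ := exists_ne (0 : V)
    apply hv
    have h1 : (0 : AddMonoid.End V) = 1 := by
      rw [← map_zero j, h, map_one]
    have h2 : (0 : AddMonoid.End V) v = (1 : AddMonoid.End V) v := by rw [h1]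
    exact h2.symm
  obtain ⟨I, hI⟩ := Ideal.exists_maximal T
  have hVT : ((Nat.card V : ℕ) : T) = 0 := by
    apply hj
    rw [map_natCast, map_zero]
    apply AddMonoidHom.ext
    intro v
    have h1 : ((Nat.card V : ℕ) : AddMonoid.End V) v = Nat.card V • v := by
      simp
    exact h1.trans card_nsmul_eq_zero'
  have hIp : I.IsPrime := hI.isPrime
  have hdom : IsDomain (T ⧸ I) := Ideal.Quotient.isDomain I
  apply isCyclic_of_injective_ringHom ((Ideal.Quotient.mk I : T →* T ⧸ I).comp f)
  rw [injective_iff_map_eq_one]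
  intro e he
  by_contra hne1
  have he' : Ideal.Quotient.mk I (f e) = 1 := he
  have hN : ∑ i ∈ Finset.range (orderOf e), (f e) ^ i = 0 := by
    have h1 : f e * (∑ i ∈ Finset.range (orderOf e), (f e) ^ i)
        = ∑ i ∈ Finset.range (orderOf e), (f e) ^ i := by
      have := mul_geom_sum (f e) (orderOf e)
      rw [← map_pow, pow_orderOf_eq_one, map_one, sub_self, sub_mul, one_mul, sub_eq_zero] at this
      exact this
    generalize (∑ i ∈ Finset.range (orderOf e), (f e) ^ i) = N at h1
    apply hj
    rw [map_zero]
    apply AddMonoidHom.ext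
    intro v
    apply hs e hne1
    have h2 : j (f e) * j N = j N := by rw [← map_mul, h1]
    have h3 : (j (f e) * j N) v = j N v := by rw [h2]
    exact h3
  have h1 : ((orderOf e : ℕ) : T ⧸ I) = 0 := by
    have := congrArg (Ideal.Quotient.mk I) hN
    rw [map_sum] at this
    simp only [map_pow, he', one_pow, Finset.sum_const, Finset.card_range, map_zero,
      nsmul_eq_mul, mul_one] at this
    exact this
  have h2 : ((Nat.card V : ℕ) : T ⧸ I) = 0 := by
    rw [← map_natCast (Ideal.Quotient.mk I), hVT, map_zero]
  have hco' : IsCoprime ((orderOf e : ℕ) : ℤ) ((Nat.card V : ℕ) : ℤ) :=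
    Nat.isCoprime_iff_coprime.2 (hco.coprime_dvd_left (orderOf_dvd_natCard e))
  obtain ⟨a, b, hab'⟩ := hco'
  have h3 := congrArg (Int.cast : ℤ → T ⧸ I) hab'
  push_cast at h3
  rw [h1, h2] at h3
  simp at h3

/-- semiregular coprime action of abelian group forces cyclic -/
theorem cyclic_of_semireg {E : Type u} [Group E] [Finite E] {V : Type v} [AddCommGroup V]
    [Finite V] [Nontrivial V] (ρ : E →* AddMonoid.End V) (hab : ∀ x y : E, x * y = y * x)
    (hco : (Nat.card E).Coprime (Nat.card V))
    (hs : ∀ e : E, e ≠ 1 → ∀ v, ρ e v = v → v = 0) : IsCyclic E := by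
  have hcomm : ∀ x ∈ Set.range ρ, ∀ y ∈ Set.range ρ, x * y = y * x := by
    rintro _ ⟨a, rfl⟩ _ ⟨b, rfl⟩
    rw [← map_mul, hab, map_mul]
  have := Subring.isMulCommutative_closure hcomm
  open scoped IsMulCommutative in
  exact cyclic_of_semireg_aux (T := Subring.closure (Set.range ρ))
    (Subring.closure (Set.range ρ)).subtype (Subtype.val_injective)
    { toFun := fun e => ⟨ρ e, Subring.subset_closure ⟨e, rfl⟩⟩
      map_one' := Subtype.ext (map_one ρ)
      map_mul' := fun a b => Subtype.ext (map_mul ρ a b) } hco hs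

theorem caseII {A : Type u} [Group A] [Finite A] [Group.IsNilpotent A] {V : Type v}
    [AddCommGroup V] [Finite V] [Nontrivial V] (ρ : A →* AddMonoid.End V)
    (hinj : Function.Injective ρ) (hco : (Nat.card A).Coprime (Nat.card V))
    (hirr : MinInv ρ ⊤)
    (hM : ∀ M : Subgroup A, IsCoatom M → ∀ U : AddSubgroup V, U ≠ ⊥ →
      Inv (ρ.comp M.subtype) U → U = ⊤) :
    (commutator A).index < Nat.card V := by
  obtain ⟨E, hEn, hEa, hEc⟩ := exists_self_centralizing (A := A)
  have hEcomm : ∀ x ∈ E, ∀ y ∈ E, x * y = y * x := fun x hx y hy =>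
    (Subgroup.mem_centralizer_iff.1 (hEa hx) y hy).symm
  have hsemi : ∀ F0 : Subgroup A, F0 ≤ E → fixedBy ρ F0 ≠ ⊥ → F0 = ⊥ := by
    intro F0 hF0 hfix
    obtain ⟨F, hF0F, hFmax⟩ := Finite.exists_le_maximal (α := Subgroup A) (a := F0)
      (p := fun F : Subgroup A => F ≤ E ∧ fixedBy ρ F ≠ ⊥) ⟨hF0, hfix⟩
    suffices F = ⊥ by rw [eq_bot_iff, ← this]; exact hF0F
    have hFE := hFmax.prop.1
    have hFf := hFmax.prop.2
    rcases eq_top_or_exists_le_coatom (Subgroup.normalizer (F : Set A)) with hN | ⟨M, hMc, hNM⟩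
    · have : F.Normal := Subgroup.normalizer_eq_top_iff.1 hN
      have h1 := hirr.2.2 _ le_top hFf fixedBy_inv
      have h2 : F ≤ fix ρ ⊤ := le_fixedBy_iff.1 h1.ge
      rw [fix_top hinj] at h2
      exact le_bot_iff.1 h2
    · exfalso
      have : Fintype F := Fintype.ofFinite F
      set W := fixedBy ρ F with hW
      let e0 : AddMonoid.End V := ∑ f : F, ρ f
      have he0 : ∀ v, e0 v = ∑ f : F, ρ f v := by
        intro v
        exact AddMonoidHom.finsetSum_apply _ _ _
      let K : AddSubgroup V := AddMonoidHom.ker e0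
      have hK : ∀ y, y ∉ M → tr ρ y W ≤ K := by
        intro y hy v hv
        change e0 v = 0
        by_contra hne
        set F' := F ⊔ F.map (MulAut.conj y).toMonoidHom with hF'
        have hmapE : F.map (MulAut.conj y).toMonoidHom ≤ E := by
          rintro _ ⟨f, hf, rfl⟩
          exact hEn.conj_mem f (hFE hf) y
        have hmem : e0 v ∈ fixedBy ρ F' := by
          have : AddSubgroup.zmultiples (e0 v) ≤ fixedBy ρ F' := by
            rw [le_fixedBy_iff]
            have hz : ∀ g, ρ g (e0 v) = e0 v → g ∈ fix ρ (AddSubgroup.zmultiples (e0 v)) := by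
              intro g hg w hw
              obtain ⟨j, rfl⟩ := AddSubgroup.mem_zmultiples_iff.1 hw
              rw [map_zsmul, hg]
            refine sup_le ?_ ?_
            · intro f hf
              apply hz
              rw [he0, map_sum]
              simp only [← rho_mul]
              exact Fintype.sum_equiv (Equiv.mulLeft (⟨f, hf⟩ : F)) _ _ (fun x => rfl)
            · rintro _ ⟨f, hf, rfl⟩
              apply hz
              rw [he0, map_sum]
              apply Finset.sum_congr rfl
              intro x _
              change ρ (y * f * y⁻¹) _ = _
              rw [← rho_mul, hEcomm _ (hEn.conj_mem f (hFE hf) y) _ (hFE x.2), rho_mul]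
              congr 1
              rw [rho_mul, rho_mul, (mem_tr.1 hv) f hf, rho_self_inv]
          exact this (AddSubgroup.mem_zmultiples _)
        have h1 : F' ≤ F := hFmax.le_of_ge ⟨sup_le hFE hmapE, by
          intro hb
          rw [hb, AddSubgroup.mem_bot] at hmem
          exact hne hmem⟩ le_sup_left
        apply hy
        apply hNM
        apply Subgroup.mem_normalizer_fintype
        intro f hf
        exact h1 ((le_sup_right : _ ≤ F') ⟨f, hf, rfl⟩)
      obtain ⟨a, ha⟩ : ∃ a, a ∉ M := by
        by_contra! h
        exact hMc.1 (eq_top_iff.2 fun x _ => h x)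
      have hY : (⨆ x : M, tr ρ (x : A) W) = ⊤ := by
        apply hM M hMc
        · intro h
          apply hFf
          rw [eq_bot_iff, ← h]
          refine le_trans (le_of_eq (tr_one ρ W).symm) (le_iSup (fun x : M => tr ρ (x : A) W) 1)
        · have key : ∀ b : M, (⨆ x : M, tr ρ (x : A) W) ≤ (⨆ x : M, tr ρ (x : A) W).comap (ρ b) := by
            intro b
            rw [iSup_le_iff]
            intro g v hv
            have h1 : ρ b v ∈ tr ρ ((b * g : M) : A) W := by
              rw [Subgroup.coe_mul, tr_mul]; exact tr_apply_mem hv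
            exact (le_iSup (fun x : M => tr ρ (x : A) W) (b * g)) h1
          exact fun b v hv => key b hv
      have hYK : (⊤ : AddSubgroup V) ≤ tr ρ a K := by
        rw [← hY, iSup_le_iff]
        intro x
        have e : tr ρ (x : A) W = tr ρ a (tr ρ (a⁻¹ * x) W) := by
          rw [← tr_mul, mul_inv_cancel_left]
        rw [e]
        apply tr_mono
        apply hK
        intro h
        apply ha
        have h2 := M.inv_mem (M.mul_mem h (M.inv_mem x.2))
        rwa [mul_inv_cancel_right, inv_inv] at h2
      have hKtop : ∀ v, e0 v = 0 := by
        intro v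
        have : ρ a v ∈ tr ρ a K := hYK trivial
        rw [mem_tr, rho_inv_self] at this
        exact this
      obtain ⟨w, hw, hw0⟩ := (AddSubgroup.bot_or_exists_ne_zero W).resolve_left hFf
      have h1 := hKtop w
      rw [he0, Finset.sum_congr rfl (fun (f : F) _ => hw f f.2), Finset.sum_const,
        Finset.card_univ, ← Nat.card_eq_fintype_card] at h1
      apply hw0
      rw [← AddMonoid.addOrderOf_eq_one_iff]
      exact Nat.eq_one_of_dvd_coprimes
        (hco.coprime_dvd_left (Subgroup.card_subgroup_dvd_card F))
        (addOrderOf_dvd_of_nsmul_eq_zero h1) (addOrderOf_dvd_natCard w)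
  have hsemi' : ∀ e : E, e ≠ 1 → ∀ v, (ρ.comp E.subtype) e v = v → v = 0 := by
    intro e he v hv
    by_contra hv0
    apply he
    have h1 := hsemi (Subgroup.zpowers (e : A)) (Subgroup.zpowers_le.2 e.2) (by
      have : AddSubgroup.zmultiples v ≤ fixedBy ρ (Subgroup.zpowers (e : A)) := by
        rw [le_fixedBy_iff, Subgroup.zpowers_le]
        intro w hw
        obtain ⟨j, rfl⟩ := AddSubgroup.mem_zmultiples_iff.1 hw
        rw [map_zsmul]
        exact congrArg _ hv
      intro hb
      rw [hb, le_bot_iff, AddSubgroup.zmultiples_eq_bot] at this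
      exact hv0 this)
    rw [Subgroup.zpowers_eq_bot] at h1
    exact Subtype.ext h1
  have hcyc : IsCyclic E := cyclic_of_semireg (ρ.comp E.subtype)
    (fun x y => Subtype.ext (hEcomm x x.2 y y.2))
    (hco.coprime_dvd_left (Subgroup.card_subgroup_dvd_card E)) hsemi'
  obtain ⟨e0, he0⟩ := hcyc.exists_generator
  have hcen : Subgroup.centralizer {(e0 : A)} = E := by
    apply le_antisymm
    · refine le_trans ?_ hEc
      intro x hx
      rw [Subgroup.mem_centralizer_iff]
      intro y hy
      obtain ⟨j, hj⟩ := Subgroup.mem_zpowers_iff.1 (he0 ⟨y, hy⟩)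
      have h1 : (e0 : A) ^ j = y := by
        rw [← Subgroup.coe_zpow, hj]
      have h2 : Commute x (e0 : A) := Subgroup.mem_centralizer_singleton_iff.1 hx
      rw [← h1]
      exact (h2.zpow_right j).symm
    · intro x hx
      rw [Subgroup.mem_centralizer_singleton_iff]
      exact hEcomm x hx e0 e0.2
  have h1 := centralizer_index_le (e0 : A)
  rw [hcen] at h1
  have h2 : (commutator A).index ≤ Nat.card E := by
    have h3 := Subgroup.card_mul_index (commutator A)
    have h4 := Subgroup.card_mul_index E
    have h5 : Nat.card (commutator A) * (commutator A).index
        ≤ Nat.card (commutator A) * Nat.card E := by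
      rw [h3, ← h4, mul_comm]; gcongr
    exact Nat.le_of_mul_le_mul_left h5 Nat.card_pos
  refine h2.trans_lt ?_
  obtain ⟨v, hv⟩ := exists_ne (0 : V)
  have h6 := index_lt_card (ρ.comp E.subtype) ⊥ ⊤ (fun _ _ _ => trivial) v trivial hv (by
    intro c hcv
    rw [Subgroup.mem_bot]
    by_contra hc1
    exact hv (hsemi' c hc1 v hcv))
  rwa [Subgroup.index_bot, AddSubgroup.card_top] at h6

theorem bound_quot_aux {n : ℕ} (hn : BoundFor.{u, v} n) {A B : Type u} {V : Type v} [Group A]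
    [Finite A] [Group.IsNilpotent A] [AddCommGroup V]
    [Finite V] [Nontrivial V] [Group B] (ρ : A →* AddMonoid.End V) (σ : A →* B)
    (hs : Function.Surjective σ) (τ : B →* AddMonoid.End V) (hτ : Function.Injective τ)
    (hk1 : σ.ker = ρ.ker)
    (hco : (Nat.card A).Coprime (Nat.card V)) (hk : ρ.ker ≠ ⊥)
    (hcn : Nat.card A + Nat.card V < n + 1) :
    (commutator A ⊔ ρ.ker).index < Nat.card V := by
  have hfin : Finite B := Finite.of_surjective σ hs
  have hnil : Group.IsNilpotent B := Group.nilpotent_of_surjective _ hs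
  have hlt : Nat.card B < Nat.card A := by
    have h1 := Subgroup.card_mul_index σ.ker
    rw [← hk1] at hk
    have h2 : 1 < Nat.card σ.ker := (Subgroup.one_lt_card_iff_ne_bot _).2 hk
    have h4 : σ.ker.index = Nat.card B := by
      rw [Subgroup.index_ker, MonoidHom.range_eq_top.2 hs, Subgroup.card_top]
    rw [h4] at h1
    rw [← h1]
    exact lt_mul_of_one_lt_left Nat.card_pos h2
  have h1 := hn B V τ (hco.coprime_dvd_left (Subgroup.card_dvd_of_surjective σ hs)) (by omega)
  rw [(MonoidHom.ker_eq_bot_iff _).2 hτ, sup_bot_eq] at h1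
  have h2 : commutator B = (commutator A).map σ := by
    rw [commutator_def, commutator_def, Subgroup.map_commutator,
      Subgroup.map_top_of_surjective _ hs]
  rw [h2, ← Subgroup.index_comap_of_surjective _ hs, Subgroup.comap_map_eq, hk1] at h1
  exact h1

theorem bound_quot {n : ℕ} (hn : BoundFor.{u, v} n) {A : Type u} {V : Type v} [Group A] [Finite A]
    [Group.IsNilpotent A] [AddCommGroup V]
    [Finite V] [Nontrivial V] (ρ : A →* AddMonoid.End V)
    (hco : (Nat.card A).Coprime (Nat.card V)) (hk : ρ.ker ≠ ⊥)
    (hcn : Nat.card A + Nat.card V < n + 1) :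
    (commutator A ⊔ ρ.ker).index < Nat.card V := by
  have h1 := QuotientGroup.mk'_surjective ρ.ker
  have h3 := QuotientGroup.ker_mk' ρ.ker
  have h4 : ∃ τ : (A ⧸ ρ.ker) →* AddMonoid.End V, ∀ a, τ (QuotientGroup.mk' ρ.ker a) = ρ a :=
    ⟨QuotientGroup.lift ρ.ker ρ (fun _ h => h), fun _ => rfl⟩
  obtain ⟨τ, h4⟩ := h4
  generalize QuotientGroup.mk' ρ.ker = σ at h1 h3 h4
  refine bound_quot_aux hn ρ σ h1 τ ?_ h3 hco hk hcn
  rw [injective_iff_map_eq_one]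
  intro b hb
  obtain ⟨a, rfl⟩ := h1 b
  rw [h4] at hb
  rw [← MonoidHom.mem_ker, h3]
  exact hb

/-- The bound lemma. -/
theorem boundFor_all : ∀ n, BoundFor.{u, v} n := by
  intro n
  induction n with
  | zero => intro A V _ _ _ _ _ _ ρ _ h; omega
  | succ n hn =>
    intro A V _ _ _ _ _ _ ρ hco hcn
    by_cases hk : ρ.ker = ⊥
    swap
    · exact bound_quot hn ρ hco hk hcn
    have hinj := (MonoidHom.ker_eq_bot_iff ρ).1 hk
    rw [hk, sup_bot_eq]
    by_cases hred : ∃ U : AddSubgroup V, U ≠ ⊥ ∧ U ≠ ⊤ ∧ Inv ρ U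
    · obtain ⟨U, hU0, hU1, hU⟩ := hred
      have hUc : Nat.card U < Nat.card V := by
        by_contra h
        exact hU1 (AddSubgroup.eq_top_of_le_card U (not_lt.1 h))
      have hmul := AddSubgroup.card_mul_index U
      have hUi : U.index < Nat.card V := by
        have h2 : 1 < Nat.card U := (AddSubgroup.one_lt_card_iff_ne_bot _).2 hU0
        have h3 : 0 < U.index := Nat.pos_of_ne_zero AddSubgroup.index_ne_zero_of_finite
        rw [← hmul]
        exact lt_mul_of_one_lt_left h3 h2
      have h1 := IH1 hn ρ hco U hU hU0 (by omega)
      have h2 := IH2 hn ρ hinj hco (fix ρ U) U hU1 le_rfl (by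
        have := Subgroup.card_le_card_group (fix ρ U); omega)
      refine (index_le_formula (fix ρ U)).trans_lt ?_
      rw [← hmul]
      exact Nat.mul_lt_mul'' h1 h2
    have hirr : MinInv ρ ⊤ := by
      refine ⟨?_, fun _ _ _ => trivial, ?_⟩
      · intro h
        have := AddSubgroup.nontrivial_iff.2 ‹Nontrivial V›
        exact bot_ne_top h.symm
      · intro W _ h0 hI
        by_contra h
        exact hred ⟨W, h0, h, hI⟩
    by_cases hI : ∃ M : Subgroup A, IsCoatom M ∧ ∃ U : AddSubgroup V, U ≠ ⊥ ∧ U ≠ ⊤ ∧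
        Inv (ρ.comp M.subtype) U
    · obtain ⟨M, hM, U, hU0, hU1, hU⟩ := hI
      obtain ⟨V1, hV1, hmin⟩ := exists_minInv _ _ U le_rfl hU0 hU
      refine caseI hn ρ hinj hco (by omega) hirr M hM V1 hmin ?_
      rintro rfl
      exact hU1 (top_le_iff.1 hV1)
    · apply caseII ρ hinj hco hirr
      intro M hM U h0 hU
      by_contra h1
      exact hI ⟨M, hM, U, h0, h1, hU⟩

end WT


namespace WT
open Subgroup
open scoped commutatorElement
universe u v

theorem transfer_lift {G : Type u} [Group G] (L N : Subgroup G) {M : Type v} [AddCommGroup M]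
    (lam : G → M)
    (hmul : ∀ d ∈ L ⊓ N, ∀ e ∈ L ⊓ N, lam (d * e) = lam d + lam e) :
    ∃ f : G → M, f 1 = 0 ∧ ∀ x, ∀ d ∈ L ⊓ N, f (x * d) = f x + lam d := by
  let r : G → G := fun x => (QuotientGroup.mk x : G ⧸ (L ⊓ N)).out
  have hr : ∀ x, (r x)⁻¹ * x ∈ L ⊓ N := by
    intro x
    rw [← QuotientGroup.eq]
    exact QuotientGroup.out_eq' _
  have hrd : ∀ x, ∀ d ∈ L ⊓ N, r (x * d) = r x := by
    intro x d hd
    have : (QuotientGroup.mk (x * d) : G ⧸ (L ⊓ N)) = QuotientGroup.mk x :=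
      QuotientGroup.mk_mul_of_mem x hd
    simp only [r, this]
  refine ⟨fun x => lam ((r x)⁻¹ * x) - lam ((r 1)⁻¹ * 1), sub_self _, ?_⟩
  intro x d hd
  simp only
  rw [hrd x d hd, ← mul_assoc, hmul _ (hr x) _ hd]
  abel

theorem transfer_cocycle {G : Type u} [Group G] (L N : Subgroup G) [N.Normal] (hLN : L ⊔ N = ⊤)
    {M : Type v} [AddCommGroup M] (lam : G → M)
    (hmul : ∀ d ∈ L ⊓ N, ∀ e ∈ L ⊓ N, lam (d * e) = lam d + lam e)
    (hinv : ∀ x ∈ L, ∀ d ∈ L ⊓ N, lam (x * d * x⁻¹) = lam d)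
    (f : G → M) (hf : ∀ x, ∀ d ∈ L ⊓ N, f (x * d) = f x + lam d) :
    ∃ c : G → G → M, ∀ x ∈ L, ∀ y ∈ L, ∀ m ∈ N, ∀ n ∈ N,
      c (x * m) (y * n) = f x + f y - f (x * y) := by
  have hl : ∀ g : G, ∃ x ∈ L, x⁻¹ * g ∈ N := by
    intro g
    have hg : g ∈ L ⊔ N := hLN ▸ Subgroup.mem_top g
    obtain ⟨x, hx, n, hn, rfl⟩ := Subgroup.mem_sup_of_normal_right.1 hg
    exact ⟨x, hx, by simpa using hn⟩
  choose l hlL hlN using hl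
  refine ⟨fun g h => f (l g) + f (l h) - f (l g * l h), ?_⟩
  intro x hx y hy m hm n hn
  have key : ∀ x ∈ L, ∀ m ∈ N, ∃ d ∈ L ⊓ N, l (x * m) = x * d := by
    intro x hx m hm
    refine ⟨x⁻¹ * l (x * m), ⟨L.mul_mem (L.inv_mem hx) (hlL _), ?_⟩, by group⟩
    have h1 := hlN (x * m)
    have h2 := mul_mem hm (inv_mem h1)
    have e : m * ((l (x * m))⁻¹ * (x * m))⁻¹ = x⁻¹ * l (x * m) := by group
    rwa [e] at h2
  obtain ⟨d, hd, h1⟩ := key x hx m hm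
  obtain ⟨e, he, h2⟩ := key y hy n hn
  have hconj : y⁻¹ * d * y⁻¹⁻¹ ∈ L ⊓ N :=
    ⟨L.mul_mem (L.mul_mem (L.inv_mem hy) hd.1) (L.inv_mem (L.inv_mem hy)),
      Subgroup.Normal.conj_mem ‹_› d hd.2 y⁻¹⟩
  have h3 : x * d * (y * e) = x * y * (y⁻¹ * d * y⁻¹⁻¹ * e) := by group
  simp only
  rw [h1, h2, h3, hf _ _ (mul_mem hconj he), hf _ _ hd, hf _ _ he, hmul _ hconj _ he,
    hinv _ (inv_mem hy) _ hd]
  abel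

theorem transfer_trivialize {G : Type u} [Group G] (L : Subgroup G)
    {M : Type v} [AddCommGroup M] (f : G → M) (hf1 : f 1 = 0) (c : G → G → M)
    (hc : ∀ x ∈ L, ∀ y ∈ L, c x y = f x + f y - f (x * y))
    (hcoc : ∀ x y z, c x y + c (x * y) z = c y z + c x (y * z)) :
    ∃ b : G → M, (∀ p ∈ L, b p = f p) ∧ ∀ p ∈ L, ∀ y, c p y = b p + b y - b (p * y) := by
  let s : G → G := fun g => (QuotientGroup.mk g⁻¹ : G ⧸ L).out
  have hs : ∀ g, g * s g ∈ L := by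
    intro g
    have : (g⁻¹)⁻¹ * s g ∈ L := by
      rw [← QuotientGroup.eq]
      exact (QuotientGroup.out_eq' _).symm
    simpa using this
  have hsp : ∀ p ∈ L, ∀ g, s (p * g) = s g := by
    intro p hp g
    have : (QuotientGroup.mk (p * g)⁻¹ : G ⧸ L) = QuotientGroup.mk g⁻¹ := by
      rw [mul_inv_rev]; exact QuotientGroup.mk_mul_of_mem _ (inv_mem hp)
    simp only [s, this]
  let b : G → M := fun g => f (g * s g) - c (g * s g) (s g)⁻¹
  have hb : ∀ p ∈ L, ∀ y, c p y = f p + b y - b (p * y) := by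
    intro p hp y
    simp only [b]
    rw [hsp p hp y]
    have h1 := hcoc p (y * s y) (s y)⁻¹
    rw [hc p hp _ (hs y), mul_inv_cancel_right, ← mul_assoc] at h1
    have h2 : c p y = f p + f (y * s y) - f (p * y * s y) + c (p * y * s y) (s y)⁻¹
      - c (y * s y) (s y)⁻¹ := by rw [h1]; abel
    rw [h2]; abel
  have hb1 : ∀ p ∈ L, b p - b 1 = f p := by
    intro p hp
    have h1 := hb p hp 1
    rw [hc p hp 1 (one_mem _), mul_one, hf1, add_zero, sub_self] at h1
    have h2 : b p - b 1 = f p - (f p + b 1 - b p) := by abel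
    rw [h2, ← h1, sub_zero]
  refine ⟨fun g => b g - b 1, hb1, ?_⟩
  intro p hp y
  simp only
  rw [hb1 p hp, hb p hp y]
  abel

theorem transfer_sum {G : Type u} [Group G] [Finite G] (L : Subgroup G)
    {M : Type v} [AddCommGroup M] (c : G → G → M)
    (hc : ∀ x ∈ L, ∀ y, c x y = 0)
    (hcoc : ∀ x y z, c x y + c (x * y) z = c y z + c x (y * z)) :
    ∃ S : G → M, ∀ x y, S x + S y - S (x * y) = L.index • c x y := by
  have : Fintype (G ⧸ L) := Fintype.ofFinite _
  have hp : ∀ p ∈ L, ∀ x y, c (p * x) y = c x y := by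
    intro p hp x y
    have := hcoc p x y
    rw [hc p hp, hc p hp, zero_add, add_zero] at this
    exact this
  let w : G → G ⧸ L → M := fun y q => c (q.out)⁻¹ y
  have hw : ∀ y g, w y (QuotientGroup.mk g) = c g⁻¹ y := by
    intro y g
    have h1 : g⁻¹ * (QuotientGroup.mk g : G ⧸ L).out ∈ L := by
      rw [← QuotientGroup.eq]
      exact (QuotientGroup.out_eq' _).symm
    have h2 := hp _ (inv_mem h1) g⁻¹ y
    simp only [w]
    rw [← h2]
    congr 1
    group
  refine ⟨fun y => ∑ q, w y q, ?_⟩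
  intro x y
  simp only
  have h1 : ∑ q, w y q = ∑ q : G ⧸ L, c ((q.out)⁻¹ * x) y := by
    rw [← Equiv.sum_comp (MulAction.toPerm x⁻¹ : Equiv.Perm (G ⧸ L))]
    apply Finset.sum_congr rfl
    intro q _
    have : (MulAction.toPerm x⁻¹ : Equiv.Perm (G ⧸ L)) q = QuotientGroup.mk (x⁻¹ * q.out) := by
      conv_lhs => rw [← QuotientGroup.out_eq' q]
      rfl
    rw [this, hw, mul_inv_rev, inv_inv]
  rw [h1, ← Finset.sum_add_distrib, ← Finset.sum_sub_distrib]
  rw [Finset.sum_congr rfl (g := fun _ => c x y)]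
  · rw [Finset.sum_const, Finset.card_univ, Subgroup.index, Nat.card_eq_fintype_card]
  · intro q _
    simp only [w]
    rw [hcoc]; abel

/-- Transfer-type lemma. -/
theorem transfer {G : Type u} [Group G] [Finite G] (L N : Subgroup G) [N.Normal]
    (hLN : L ⊔ N = ⊤) {M : Type v} [AddCommGroup M] (lam : G → M)
    (hmul : ∀ d ∈ L ⊓ N, ∀ e ∈ L ⊓ N, lam (d * e) = lam d + lam e)
    (hinv : ∀ x ∈ L, ∀ d ∈ L ⊓ N, lam (x * d * x⁻¹) = lam d)
    (hext : ∀ φ : G → M, (∀ x ∈ L, ∀ y ∈ L, φ (x * y) = φ x + φ y) →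
      ∃ θ : G → M, (∀ x y, θ (x * y) = θ x + θ y) ∧ ∀ x ∈ L, θ x = φ x) :
    ∃ Φ : G → M, (∀ a ∈ N, ∀ b ∈ N, Φ (a * b) = Φ a + Φ b) ∧
      ∀ d ∈ L ⊓ N, Φ d = L.index • lam d := by
  obtain ⟨f, hf1, hf⟩ := transfer_lift L N lam hmul
  obtain ⟨c, hc⟩ := transfer_cocycle L N hLN lam hmul hinv f hf
  have hdec : ∀ g : G, ∃ x ∈ L, ∃ n ∈ N, x * n = g := by
    intro g
    have hg : g ∈ L ⊔ N := hLN ▸ Subgroup.mem_top g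
    exact Subgroup.mem_sup_of_normal_right.1 hg
  have hcoc : ∀ x y z, c x y + c (x * y) z = c y z + c x (y * z) := by
    intro x y z
    obtain ⟨x, hx, l, hl, rfl⟩ := hdec x
    obtain ⟨y, hy, m, hm, rfl⟩ := hdec y
    obtain ⟨z, hz, n, hn, rfl⟩ := hdec z
    have e1 : x * l * (y * m) = x * y * (y⁻¹ * l * y⁻¹⁻¹ * m) := by group
    have e2 : y * m * (z * n) = y * z * (z⁻¹ * m * z⁻¹⁻¹ * n) := by group
    rw [hc x hx y hy l hl m hm, hc y hy z hz m hm n hn, e1, e2,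
      hc (x * y) (mul_mem hx hy) z hz _
        (mul_mem (Subgroup.Normal.conj_mem ‹_› l hl y⁻¹) hm) n hn,
      hc x hx (y * z) (mul_mem hy hz) l hl _
        (mul_mem (Subgroup.Normal.conj_mem ‹_› m hm z⁻¹) hn), mul_assoc]
    abel
  have hcL : ∀ x ∈ L, ∀ y ∈ L, c x y = f x + f y - f (x * y) := by
    intro x hx y hy
    have := hc x hx y hy 1 (one_mem _) 1 (one_mem _)
    rwa [mul_one, mul_one] at this
  have hcN : ∀ x ∈ N, ∀ y ∈ N, c x y = 0 := by
    intro x hx y hy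
    have := hc 1 (one_mem _) 1 (one_mem _) x hx y hy
    rw [one_mul, one_mul, one_mul, hf1] at this
    simpa using this
  obtain ⟨b, hb1, hb2⟩ := transfer_trivialize L f hf1 c hcL hcoc
  obtain ⟨S, hS⟩ := transfer_sum L (fun x y => c x y - (b x + b y - b (x * y)))
    (fun x hx y => by rw [hb2 x hx y, sub_self]) (by
      intro x y z
      have h1 := hcoc x y z
      have h2 : c x y = c y z + c x (y * z) - c (x * y) z := by rw [← h1]; abel
      rw [h2, mul_assoc]; abel)
  let F : G → M := fun x => L.index • b x + S x
  have hF : ∀ x y, F (x * y) = F x + F y - L.index • c x y := by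
    intro x y
    have h1 := hS x y
    rw [smul_sub, smul_sub, smul_add] at h1
    have h2 : L.index • c x y = S x + S y - S (x * y) +
      (L.index • b x + L.index • b y - L.index • b (x * y)) := by rw [h1]; abel
    simp only [F]
    rw [h2]; abel
  obtain ⟨θ, hθ, hθL⟩ := hext (fun x => F x - L.index • f x) (by
    intro x hx y hy
    rw [hF, hcL x hx y hy, smul_sub, smul_add]
    abel)
  refine ⟨fun x => F x - θ x, ?_, ?_⟩
  · intro x hx y hy
    simp only
    rw [hF, hcN x hx y hy, hθ, smul_zero]
    abel
  · intro d hd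
    simp only
    rw [hθL d hd.1]
    have := hf 1 d hd
    rw [one_mul, hf1, zero_add] at this
    rw [this]
    abel

end WT


namespace WT
open Subgroup
open scoped commutatorElement
universe u v

/-- Weakly-top via indices. -/
def WTop (G : Type u) [Group G] : Prop :=
  ∀ H : Subgroup G, (commutator H).index ≤ (commutator G).index

theorem comm_index_congr {A : Type u} {B : Type v} [Group A] [Group B] (e : A ≃* B) :
    (commutator A).index = (commutator B).index :=
  Nat.card_congr (e.abelianizationCongr).toEquiv

theorem comm_index_le_of_surj {A : Type u} {B : Type v} [Group A] [Group B] [Finite A]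
    (f : A →* B) (hf : Function.Surjective f) :
    (commutator B).index ≤ (commutator A).index := by
  have hs : Function.Surjective (Abelianization.map f) := by
    intro b
    obtain ⟨b, rfl⟩ := QuotientGroup.mk'_surjective (commutator B) b
    obtain ⟨a, rfl⟩ := hf b
    exact ⟨Abelianization.of a, rfl⟩
  have : Finite (Abelianization A) := inferInstanceAs (Finite (A ⧸ commutator A))
  exact Nat.card_le_card_of_surjective _ hs

theorem index_sup_top {G : Type u} [Group G] {H : Subgroup G} (h : H ⊔ commutator G = ⊤) :
    (commutator G).index = (commutator G).relIndex H := by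
  rw [index_sup_formula H, sup_comm, h, Subgroup.index_top, one_mul]

theorem comm_index_le_of_sup {G : Type u} [Group G] [Finite G] {H : Subgroup G}
    (h : H ⊔ commutator G = ⊤) : (commutator G).index ≤ (commutator H).index := by
  rw [index_sup_top h, ← relIndex_comm_self]
  exact Subgroup.relIndex_le_of_le_left (comm_le_commutator H)
    (Subgroup.index_ne_zero_of_finite)

theorem WTop.inf_le {G : Type u} [Group G] [Finite G] (hG : WTop G) {H : Subgroup G}
    (h : H ⊔ commutator G = ⊤) : H ⊓ commutator G ≤ ⁅H, H⁆ := by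
  have h1 := hG H
  rw [← relIndex_comm_self, index_sup_top h] at h1
  have h2 := Subgroup.relIndex_mul_relIndex ⁅H, H⁆ (H ⊓ commutator G) H
    (le_inf (Subgroup.commutator_le_self H) (comm_le_commutator H)) inf_le_left
  rw [Subgroup.inf_relIndex_left] at h2
  rw [← Subgroup.relIndex_eq_one]
  have h3 : 0 < (commutator G).relIndex H := Nat.pos_of_ne_zero Subgroup.index_ne_zero_of_finite
  have h4 : 0 < (⁅H, H⁆).relIndex (H ⊓ commutator G) :=
    Nat.pos_of_ne_zero Subgroup.index_ne_zero_of_finite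
  by_contra h5
  have h6 : 2 ≤ (⁅H, H⁆).relIndex (H ⊓ commutator G) := by omega
  have h7 := Nat.mul_le_mul_right ((commutator G).relIndex H) h6
  omega

theorem WTop.sub {G : Type u} [Group G] [Finite G] (hG : WTop G) {H : Subgroup G}
    (h : H ⊔ commutator G = ⊤) : WTop H := by
  intro K
  refine le_trans ?_ (comm_index_le_of_sup h)
  rw [comm_index_congr (K.equivMapOfInjective H.subtype H.subtype_injective)]
  exact hG _

theorem WTop.quot {G : Type u} {B : Type v} [Group G] [Finite G] [Group B] (hG : WTop G)
    (σ : G →* B) (hs : Function.Surjective σ) (hk : σ.ker ≤ commutator G) : WTop B := by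
  intro H
  have h2 : commutator B = (commutator G).map σ := by
    rw [commutator_def, commutator_def, Subgroup.map_commutator,
      Subgroup.map_top_of_surjective _ hs]
  rw [h2, ← Subgroup.index_comap_of_surjective _ hs, Subgroup.comap_map_eq, sup_eq_left.2 hk]
  refine le_trans ?_ (hG (H.comap σ))
  apply comm_index_le_of_surj (σ.subgroupComap H)
  rintro ⟨b, hb⟩
  obtain ⟨a, rfl⟩ := hs b
  exact ⟨⟨a, hb⟩, rfl⟩

theorem hom_vanish {G : Type u} [Group G] (L : Subgroup G) {M : Type v} [AddCommGroup M]
    (φ : G → M) (hφ : ∀ x ∈ L, ∀ y ∈ L, φ (x * y) = φ x + φ y) : ∀ x ∈ ⁅L, L⁆, φ x = 0 := by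
  have h1 : φ 1 = 0 := by
    have := hφ 1 (one_mem _) 1 (one_mem _)
    simpa using this
  let ψ : L →* Multiplicative M :=
    { toFun := fun x => Multiplicative.ofAdd (φ x)
      map_one' := by simp [h1]
      map_mul' := fun x y => by
        rw [Subgroup.coe_mul, hφ x x.2 y y.2, ofAdd_add] }
  intro x hx
  rw [← Subgroup.map_subtype_commutator] at hx
  obtain ⟨y, hy, rfl⟩ := hx
  have := Abelianization.commutator_subset_ker ψ hy
  exact this

theorem hom_extend {G : Type u} [Group G] (L : Subgroup G) (h : L ⊔ commutator G = ⊤)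
    (h' : L ⊓ commutator G ≤ ⁅L, L⁆) {M : Type v} [AddCommGroup M]
    (φ : G → M) (hφ : ∀ x ∈ L, ∀ y ∈ L, φ (x * y) = φ x + φ y) :
    ∃ θ : G → M, (∀ x y, θ (x * y) = θ x + θ y) ∧ ∀ x ∈ L, θ x = φ x := by
  have hv := hom_vanish L φ hφ
  have hl : ∀ g : G, ∃ x ∈ L, x⁻¹ * g ∈ commutator G := by
    intro g
    have hg : g ∈ L ⊔ commutator G := h ▸ Subgroup.mem_top g
    obtain ⟨x, hx, n, hn, rfl⟩ := Subgroup.mem_sup_of_normal_right.1 hg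
    exact ⟨x, hx, by simpa using hn⟩
  choose l hlL hlN using hl
  have key : ∀ g, ∀ x ∈ L, x⁻¹ * g ∈ commutator G → φ (l g) = φ x := by
    intro g x hx hxg
    have h1 : x⁻¹ * l g ∈ ⁅L, L⁆ := by
      apply h'
      refine ⟨L.mul_mem (L.inv_mem hx) (hlL _), ?_⟩
      have := mul_mem hxg (inv_mem (hlN g))
      have e : x⁻¹ * g * ((l g)⁻¹ * g)⁻¹ = x⁻¹ * l g := by group
      rwa [e] at this
    have h2 := hφ x hx (x⁻¹ * l g) (L.mul_mem (L.inv_mem hx) (hlL _))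
    rw [hv _ h1, mul_inv_cancel_left, add_zero] at h2
    exact h2
  refine ⟨fun g => φ (l g), ?_, ?_⟩
  · intro x y
    rw [← hφ _ (hlL x) _ (hlL y)]
    apply key _ _ (L.mul_mem (hlL x) (hlL y))
    have e : (l x * l y)⁻¹ * (x * y) = ((l y)⁻¹ * ((l x)⁻¹ * x) * (l y)⁻¹⁻¹) * ((l y)⁻¹ * y) := by
      group
    rw [e]
    exact mul_mem (Subgroup.Normal.conj_mem inferInstance _ (hlN x) _) (hlN y)
  · intro x hx
    apply key _ _ hx
    rw [inv_mul_cancel]; exact one_mem _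

/-- Nilpotent group: normal `q`-complement. -/
theorem exists_q_complement {L : Type u} [Group L] [Finite L] [Group.IsNilpotent L] (q : ℕ)
    [Fact q.Prime] : ∃ K : Subgroup L, K.Normal ∧ (Nat.card K).Coprime q ∧ ∃ k, K.index = q ^ k := by
  obtain ⟨P⟩ : Nonempty (Sylow q L) := inferInstance
  have hP : ∀ (p : ℕ) (_ : Fact p.Prime) (P : Sylow p L), (P : Subgroup L).Normal :=
    ((Group.isNilpotent_of_finite_tfae (G := L)).out 0 3).1 ‹_›
  have hPn := hP q inferInstance P
  obtain ⟨K, hK⟩ := Subgroup.exists_right_complement'_of_coprime P.card_coprime_index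
  have hKc : (Nat.card K).Coprime q := by
    rw [← hK.symm.index_eq_card]
    exact ((Fact.out : q.Prime).coprime_iff_not_dvd.2 P.not_dvd_index).symm
  obtain ⟨k, hk⟩ := IsPGroup.iff_card.1 P.isPGroup'
  refine ⟨K, ?_, hKc, k, ?_⟩
  · rw [← Subgroup.normalizer_eq_top_iff, eq_top_iff, ← hK.sup_eq_top]
    refine sup_le ?_ Subgroup.le_normalizer
    intro x hx
    apply Subgroup.mem_normalizer_fintype
    intro y hy
    have h1 : x * y = y * x := by
      apply nilp_commute
      have h2 : orderOf x ∣ q ^ k := hk ▸ (Subgroup.orderOf_dvd_natCard _ hx)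
      have h3 : orderOf y ∣ Nat.card K := Subgroup.orderOf_dvd_natCard _ hy
      exact Nat.Coprime.coprime_dvd_left h2
        (Nat.Coprime.coprime_dvd_right h3 (Nat.Coprime.pow_left _ hKc.symm))
    rw [h1, mul_inv_cancel_right]; exact hy
  · rw [hK.index_eq_card, hk]

end WT


namespace WT
open Subgroup
open scoped commutatorElement
universe u v

/-- The homomorphism used in the transfer argument -/
theorem exists_lam {G : Type u} [Group G] [Finite G] (L N : Subgroup G) [N.Normal]
    [Group.IsNilpotent L] (q : ℕ) [Fact q.Prime] (hq : q ∣ Nat.card (L ⊓ N : Subgroup G))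
    (n : ℕ) (hn : ¬ q ∣ n) :
    ∃ (M : Type u) (_ : AddCommGroup M) (lam : G → M),
      (∀ d ∈ L ⊓ N, ∀ e ∈ L ⊓ N, lam (d * e) = lam d + lam e) ∧
      (∀ x ∈ L, ∀ d ∈ L ⊓ N, lam (x * d * x⁻¹) = lam d) ∧
      ∃ d ∈ L ⊓ N, n • lam d ≠ 0 := by
  obtain ⟨K, hKn, hKc, k, hKi⟩ := exists_q_complement (L := L) q
  set D := N.subgroupOf L with hD
  have hDn : D.Normal := Subgroup.Normal.subgroupOf ‹_› L
  set J := K ⊔ ⁅D, (⊤ : Subgroup L)⁆ with hJ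
  have hJn : J.Normal := inferInstance
  have hDJ : ¬ D ≤ J := by
    intro h
    have h1 : D ≤ K := nilp_sup K D h
    have h2 : Nat.card D ∣ Nat.card K := Subgroup.card_dvd_of_le h1
    have h3 : Nat.card D = Nat.card (L ⊓ N : Subgroup G) := by
      rw [hD, inf_comm]
      have := Nat.card_congr (Subgroup.subgroupOfEquivOfLe
        (inf_le_right : N ⊓ L ≤ L)).toEquiv
      rwa [Subgroup.inf_subgroupOf_right] at this
    have h4 : q ∣ Nat.card K := (hq.trans (dvd_of_eq h3.symm)).trans h2
    exact ((Fact.out : q.Prime).coprime_iff_not_dvd.1 hKc.symm) h4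
  obtain ⟨d0, hd0, hd0J⟩ := Set.not_subset.1 hDJ
  have hcen : ∀ d ∈ D, (QuotientGroup.mk d : L ⧸ J) ∈ Subgroup.center (L ⧸ J) := by
    intro d hd
    rw [Subgroup.mem_center_iff]
    intro g
    obtain ⟨g, rfl⟩ := QuotientGroup.mk_surjective g
    rw [← QuotientGroup.mk_mul, ← QuotientGroup.mk_mul, QuotientGroup.eq]
    have : ⁅d⁻¹, g⁻¹⁆ ∈ J :=
      (le_sup_right : _ ≤ J) (Subgroup.commutator_mem_commutator (inv_mem hd) (Subgroup.mem_top _))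
    rw [commutatorElement_def] at this
    have e : (g * d)⁻¹ * (d * g) = d⁻¹ * g⁻¹ * d⁻¹⁻¹ * g⁻¹⁻¹ := by group
    rwa [e]
  classical
  let lam : G → Additive (Subgroup.center (L ⧸ J)) := fun g =>
    if h : g ∈ L ⊓ N then
      Additive.ofMul ⟨(QuotientGroup.mk (⟨g, h.1⟩ : L) : L ⧸ J), hcen _ h.2⟩ else 0
  have hlam : ∀ g (h : g ∈ L ⊓ N), lam g =
      Additive.ofMul ⟨(QuotientGroup.mk (⟨g, h.1⟩ : L) : L ⧸ J), hcen _ h.2⟩ := by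
    intro g h
    simp only [lam, dif_pos h]
  open scoped IsMulCommutative in
  refine ⟨Additive (Subgroup.center (L ⧸ J)), inferInstance, lam, ?_, ?_, ?_⟩
  · intro d hd e he
    rw [hlam _ (mul_mem hd he), hlam _ hd, hlam _ he]
    rfl
  · intro x hx d hd
    have hm : x * d * x⁻¹ ∈ L ⊓ N :=
      ⟨L.mul_mem (L.mul_mem hx hd.1) (L.inv_mem hx), Subgroup.Normal.conj_mem ‹_› d hd.2 x⟩
    rw [hlam _ hm, hlam _ hd]
    congr 1
    apply Subtype.ext
    change (QuotientGroup.mk (⟨x, hx⟩ * ⟨d, hd.1⟩ * (⟨x, hx⟩)⁻¹ : L) : L ⧸ J) = _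
    have h1 := Subgroup.mem_center_iff.1 (hcen ⟨d, hd.1⟩ hd.2) (QuotientGroup.mk ⟨x, hx⟩)
    rw [QuotientGroup.mk_mul, QuotientGroup.mk_mul, h1, QuotientGroup.mk_inv, mul_inv_cancel_right]
  · refine ⟨d0, ⟨d0.2, hd0⟩, ?_⟩
    intro h0
    have hm : (d0 : G) ∈ L ⊓ N := ⟨d0.2, hd0⟩
    rw [hlam _ hm] at h0
    have h1 : (QuotientGroup.mk d0 : L ⧸ J) ^ n = 1 := by
      have := congrArg (fun z => ((Additive.toMul z : Subgroup.center (L ⧸ J)) : L ⧸ J)) h0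
      exact this
    have h2 : (QuotientGroup.mk d0 : L ⧸ J) ^ (q ^ k) = 1 := by
      rw [← QuotientGroup.mk_pow, QuotientGroup.eq_one_iff]
      have h3 : J.index ∣ q ^ k := hKi ▸ Subgroup.index_dvd_of_le le_sup_left
      obtain ⟨m, hm⟩ := h3
      rw [hm, pow_mul]
      exact pow_mem (Subgroup.pow_index_mem J d0) m
    have h3 : Nat.Coprime n (q ^ k) :=
      Nat.Coprime.pow_right k ((Fact.out : q.Prime).coprime_iff_not_dvd.2 hn).symm
    have h4 : orderOf (QuotientGroup.mk d0 : L ⧸ J) = 1 :=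
      Nat.eq_one_of_dvd_coprimes h3 (orderOf_dvd_of_pow_eq_one h1) (orderOf_dvd_of_pow_eq_one h2)
    rw [orderOf_eq_one_iff, QuotientGroup.eq_one_iff] at h4
    exact hd0J h4

/-- A minimal normal subgroup inside the commutator has normal Sylow subgroups. -/
theorem sylow_normal {G : Type u} [Group G] [Finite G] (hG : WTop G)
    (IH : ∀ H : Subgroup G, Nat.card H < Nat.card G → WTop H → Group.IsNilpotent H)
    (N : Subgroup G) [N.Normal] (hNG : N ≤ commutator G)
    (hmin : ∀ K : Subgroup G, K ≤ N → K.Normal → K = ⊥ ∨ K = N) (q : ℕ) [Fact q.Prime]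
    (hq : q ∣ Nat.card N) (Q : Sylow q N) : ((Q : Subgroup N).map N.subtype).Normal := by
  by_contra hQ
  set Q' := (Q : Subgroup N).map N.subtype with hQ'
  set L := Subgroup.normalizer (Q' : Set G) with hL
  have hLN : L ⊔ N = ⊤ := Sylow.normalizer_sup_eq_top Q
  have hLG : L ⊔ commutator G = ⊤ := by
    rw [eq_top_iff, ← hLN]; exact sup_le_sup_left hNG L
  have hLtop : L ≠ ⊤ := fun h => hQ (Subgroup.normalizer_eq_top_iff.1 h)
  have hLc : Nat.card L < Nat.card G := by
    by_contra h
    exact hLtop (Subgroup.eq_top_of_le_card L (not_lt.1 h))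
  have hLnil : Group.IsNilpotent L := IH L hLc (hG.sub hLG)
  have hQcard : Nat.card Q' = Nat.card (Q : Subgroup N) :=
    (Nat.card_congr ((Q : Subgroup N).equivMapOfInjective N.subtype N.subtype_injective).toEquiv).symm
  have hQLN : Q' ≤ L ⊓ N := le_inf Subgroup.le_normalizer (by
    rintro _ ⟨x, _, rfl⟩; exact x.2)
  have hqQ : q ∣ Nat.card Q' := by
    rw [hQcard]; exact Q.dvd_card_of_dvd_card hq
  have hqD : q ∣ Nat.card (L ⊓ N : Subgroup G) := hqQ.trans (Subgroup.card_dvd_of_le hQLN)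
  have hn : ¬ q ∣ L.index := by
    intro h
    apply Q.not_dvd_index
    refine h.trans ?_
    have e1 := Subgroup.card_mul_index L
    have e2 := Subgroup.card_mul_index N
    have e3 : N.index = N.relIndex L := by
      rw [← Subgroup.relIndex_top_right, ← hLN, Subgroup.relIndex_sup_right]
    have e4 : Nat.card (L ⊓ N : Subgroup G) * N.relIndex L = Nat.card L := by
      have := Subgroup.card_mul_index (N.subgroupOf L)
      rw [← this]
      congr 1
      have h2 := Nat.card_congr (Subgroup.subgroupOfEquivOfLe
        (inf_le_right : N ⊓ L ≤ L)).toEquiv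
      rw [Subgroup.inf_subgroupOf_right] at h2
      rw [h2, inf_comm]
    have e5 := Subgroup.card_mul_index (Q : Subgroup N)
    obtain ⟨m, hm⟩ := Subgroup.card_dvd_of_le hQLN
    have hN0 : 0 < N.index := Nat.pos_of_ne_zero Subgroup.index_ne_zero_of_finite
    have hQ0 : 0 < Nat.card (Q : Subgroup N) := Nat.card_pos
    refine ⟨m, ?_⟩
    apply Nat.eq_of_mul_eq_mul_left hQ0
    apply Nat.eq_of_mul_eq_mul_right hN0
    rw [e5, e2, ← e1, ← e4, hm, hQcard, e3]
    ring
  obtain ⟨M, _, lam, h1, h2, d, hd, hd0⟩ := exists_lam L N q hqD L.index hn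
  obtain ⟨Φ, hΦ, hΦd⟩ := transfer L N hLN lam h1 h2
    (fun φ hφ => hom_extend L hLG (hG.inf_le hLG) φ hφ)
  have hv := hom_vanish N Φ hΦ
  have hNN : ⁅N, N⁆ = ⊥ := by
    rcases hmin ⁅N, N⁆ (Subgroup.commutator_le_self N) inferInstance with h | h
    · exact h
    · exfalso
      apply hd0
      rw [← hΦd d hd]
      apply hv
      rw [h]; exact hd.2
  have hNc : N ≤ Subgroup.centralizer (N : Set G) :=
    Subgroup.commutator_eq_bot_iff_le_centralizer.1 hNN
  have hQn : (Q : Subgroup N).Normal := by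
    constructor
    intro x hx g
    have : g * x = x * g := Subtype.ext (Subgroup.mem_centralizer_iff.1 (hNc x.2) g g.2)
    rw [this, mul_inv_cancel_right]; exact hx
  have hch := Q.characteristic_of_normal hQn
  exact hQ ConjAct.normal_of_characteristic_of_normal

end WT


namespace WT
open Subgroup
open scoped commutatorElement
universe u v

theorem coprime_of_irr {A : Type u} [Group A] [Finite A] [Group.IsNilpotent A] {V : Type v}
    [AddCommGroup V] [Finite V] (ρ : A →* AddMonoid.End V) (hinj : Function.Injective ρ)
    (q : ℕ) [Fact q.Prime] (k : ℕ) (hV : Nat.card V = q ^ k) (hqV : q ∣ Nat.card V)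
    (hirr : MinInv ρ ⊤) : (Nat.card A).Coprime (Nat.card V) := by
  rw [hV]
  apply Nat.Coprime.pow_right
  apply Nat.Coprime.symm
  rw [(Fact.out : q.Prime).coprime_iff_not_dvd]
  intro hq
  obtain ⟨P⟩ : Nonempty (Sylow q A) := inferInstance
  have hP : ∀ (p : ℕ) (_ : Fact p.Prime) (P : Sylow p A), (P : Subgroup A).Normal :=
    ((Group.isNilpotent_of_finite_tfae (G := A)).out 0 3).1 ‹_›
  have hPn := hP q inferInstance P
  letI : MulAction (P : Subgroup A) V := MulAction.compHom V (ρ.comp (P : Subgroup A).subtype)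
  have hsm : ∀ (g : (P : Subgroup A)) (v : V), g • v = ρ g v := fun _ _ => rfl
  obtain ⟨b, hb, hb0⟩ := P.isPGroup'.exists_fixed_point_of_prime_dvd_card_of_fixed_point V hqV
    (a := 0) (fun g => by rw [hsm, map_zero])
  have h1 : fixedBy ρ P ≠ ⊥ := by
    intro h
    apply hb0
    have : b ∈ fixedBy ρ P := by
      intro a ha
      exact hb ⟨a, ha⟩
    rw [h, AddSubgroup.mem_bot] at this
    exact this.symm
  have h2 := hirr.2.2 _ le_top h1 fixedBy_inv
  have h3 : (P : Subgroup A) ≤ fix ρ ⊤ := le_fixedBy_iff.1 h2.ge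
  rw [fix_top hinj, le_bot_iff] at h3
  have h4 := P.dvd_card_of_dvd_card hq
  rw [h3, Subgroup.card_bot] at h4
  exact (Fact.out : q.Prime).one_lt.ne' (Nat.dvd_one.1 h4)

theorem bound_irr_aux {A B : Type u} [Group A] [Finite A] [Group.IsNilpotent A] {V : Type v}
    [AddCommGroup V] [Finite V] [Nontrivial V] [Group B] (ρ : A →* AddMonoid.End V) (σ : A →* B)
    (hs : Function.Surjective σ) (τ : B →* AddMonoid.End V) (hτ : Function.Injective τ)
    (hk1 : σ.ker = ρ.ker) (hcomp : ∀ a, τ (σ a) = ρ a)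
    (q : ℕ) [Fact q.Prime] (k : ℕ) (hV : Nat.card V = q ^ k) (hqV : q ∣ Nat.card V)
    (hirr : MinInv ρ ⊤) :
    (commutator A ⊔ ρ.ker).index < Nat.card V := by
  have hfin : Finite B := Finite.of_surjective σ hs
  have hnil : Group.IsNilpotent B := Group.nilpotent_of_surjective _ hs
  have hirr' : MinInv τ ⊤ := by
    refine ⟨hirr.1, fun _ _ _ => trivial, ?_⟩
    intro W hW h0 hI
    apply hirr.2.2 W hW h0
    intro a v hv
    rw [← hcomp]
    exact hI _ _ hv
  have hco := coprime_of_irr τ hτ q k hV hqV hirr'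
  have h1 := boundFor_all (Nat.card B + Nat.card V + 1) B V τ hco (by omega)
  rw [(MonoidHom.ker_eq_bot_iff _).2 hτ, sup_bot_eq] at h1
  have h2 : commutator B = (commutator A).map σ := by
    rw [commutator_def, commutator_def, Subgroup.map_commutator,
      Subgroup.map_top_of_surjective _ hs]
  rw [h2, ← Subgroup.index_comap_of_surjective _ hs, Subgroup.comap_map_eq, hk1] at h1
  exact h1

theorem bound_irr {A : Type u} [Group A] [Finite A] [Group.IsNilpotent A] {V : Type v}
    [AddCommGroup V] [Finite V] [Nontrivial V] (ρ : A →* AddMonoid.End V)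
    (q : ℕ) [Fact q.Prime] (k : ℕ) (hV : Nat.card V = q ^ k) (hqV : q ∣ Nat.card V)
    (hirr : MinInv ρ ⊤) :
    (commutator A ⊔ ρ.ker).index < Nat.card V := by
  have h1 := QuotientGroup.mk'_surjective ρ.ker
  have h3 := QuotientGroup.ker_mk' ρ.ker
  have h4 : ∃ τ : (A ⧸ ρ.ker) →* AddMonoid.End V, ∀ a, τ (QuotientGroup.mk' ρ.ker a) = ρ a :=
    ⟨QuotientGroup.lift ρ.ker ρ (fun _ h => h), fun _ => rfl⟩
  obtain ⟨τ, h4⟩ := h4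
  generalize QuotientGroup.mk' ρ.ker = σ at h1 h3 h4
  refine bound_irr_aux ρ σ h1 τ ?_ h3 h4 q k hV hqV hirr
  rw [injective_iff_map_eq_one]
  intro b hb
  obtain ⟨a, rfl⟩ := h1 b
  rw [h4] at hb
  rw [← MonoidHom.mem_ker, h3]
  exact hb

/-- The affine case. -/
theorem affine_case {G : Type u} [Group G] [Finite G] (hG : WTop G) (N H : Subgroup G) [N.Normal]
    [Group.IsNilpotent H] (hNG : N ≤ commutator G) (hNc : N ≤ Subgroup.centralizer (N : Set G))
    (hN0 : N ≠ ⊥) (hmin : ∀ K : Subgroup G, K ≤ N → K.Normal → K = ⊥ ∨ K = N)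
    (q : ℕ) [Fact q.Prime] (k : ℕ) (hN : Nat.card N = q ^ k) (hqN : q ∣ Nat.card N)
    (hsup : H ⊔ N = ⊤) (hinf : H ⊓ N = ⊥) : False := by
  have hcomm : ∀ x ∈ N, ∀ y ∈ N, x * y = y * x := fun x hx y hy =>
    (Subgroup.mem_centralizer_iff.1 (hNc hx) y hy).symm
  have hmc : IsMulCommutative N := .of_setLike_mul_comm fun x hx y hy => hcomm x hx y hy
  obtain ⟨V, _, ⟨e⟩⟩ : ∃ (V : Type u) (_ : AddCommGroup V), Nonempty (N ≃* Multiplicative V) := by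
    open scoped IsMulCommutative in
    exact ⟨Additive N, inferInstance, ⟨MulEquiv.refl _⟩⟩
  have hVfin : Finite V := Finite.of_equiv N e.toEquiv
  have hVcard : Nat.card V = Nat.card N := (Nat.card_congr e.toEquiv).symm
  let act : G → AddMonoid.End V := fun g =>
    AddMonoidHom.mk' (fun v => Multiplicative.toAdd
      (e (MulAut.conjNormal g (e.symm (Multiplicative.ofAdd v))))) (by
        intro a b
        rw [ofAdd_add, map_mul, map_mul, map_mul, toAdd_mul])
  have hact : ∀ g v, act g v = Multiplicative.toAdd
      (e (MulAut.conjNormal g (e.symm (Multiplicative.ofAdd v)))) := fun _ _ => rfl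
  have hact' : ∀ g v, ((e.symm (Multiplicative.ofAdd (act g v)) : N) : G)
      = g * (e.symm (Multiplicative.ofAdd v) : N) * g⁻¹ := by
    intro g v
    rw [hact, ofAdd_toAdd, MulEquiv.symm_apply_apply, MulAut.conjNormal_apply]
  have hext : ∀ v w : V, ((e.symm (Multiplicative.ofAdd v) : N) : G)
      = (e.symm (Multiplicative.ofAdd w) : N) → v = w := by
    intro v w h
    exact Multiplicative.ofAdd.injective (e.symm.injective (Subtype.ext h))
  let ρ : H →* AddMonoid.End V :=
    { toFun := fun h => act h
      map_one' := by
        apply AddMonoidHom.ext; intro v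
        apply hext
        refine (hact' 1 v).trans ?_
        rw [one_mul, inv_one, mul_one]
        rfl
      map_mul' := by
        intro a b
        apply AddMonoidHom.ext; intro v
        apply hext
        refine (hact' (a * b : H) v).trans (Eq.trans ?_ (hact' a (act b v)).symm)
        rw [hact', Subgroup.coe_mul]
        group }
  have hρ : ∀ (h : H) v, ρ h v = act h v := fun _ _ => rfl
  have hVnt : Nontrivial V := by
    rw [← Finite.one_lt_card_iff_nontrivial, hVcard]
    exact (Subgroup.one_lt_card_iff_ne_bot _).2 hN0
  have hirr : MinInv ρ ⊤ := by
    refine ⟨?_, fun _ _ _ => trivial, ?_⟩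
    · intro h
      have := AddSubgroup.nontrivial_iff.2 hVnt
      exact bot_ne_top h.symm
    · intro W _ hW0 hI
      let W' : Subgroup N := (AddSubgroup.toSubgroup W).comap e.toMonoidHom
      have hmemW : ∀ x : N, x ∈ W' ↔ Multiplicative.toAdd (e x) ∈ W := fun _ => Iff.rfl
      have hWn : (W'.map N.subtype).Normal := by
        rw [← Subgroup.normalizer_eq_top_iff, eq_top_iff, ← hsup]
        refine sup_le ?_ ?_
        · intro h hh
          apply Subgroup.mem_normalizer_fintype
          rintro _ ⟨x, hx, rfl⟩
          have h1 := hI ⟨h, hh⟩ _ ((hmemW x).1 hx)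
          refine ⟨e.symm (Multiplicative.ofAdd (ρ ⟨h, hh⟩ (Multiplicative.toAdd (e x)))), ?_, ?_⟩
          · change _ ∈ W'
            rw [hmemW, MulEquiv.apply_symm_apply, toAdd_ofAdd]; exact h1
          · change ((e.symm (Multiplicative.ofAdd (act h _)) : N) : G) = _
            rw [hact', ofAdd_toAdd, MulEquiv.symm_apply_apply]
            rfl
        · intro n hn
          apply Subgroup.mem_normalizer_fintype
          rintro _ ⟨x, hx, rfl⟩
          have : n * N.subtype x = N.subtype x * n := hcomm _ hn _ x.2
          rw [this, mul_inv_cancel_right]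
          exact ⟨x, hx, rfl⟩
      rcases hmin _ (by rintro _ ⟨x, _, rfl⟩; exact x.2) hWn with h | h
      · exfalso
        apply hW0
        rw [eq_bot_iff]
        intro w hw
        have h1 : N.subtype (e.symm (Multiplicative.ofAdd w)) ∈ W'.map N.subtype :=
          ⟨_, by
            change _ ∈ W'
            rw [hmemW, MulEquiv.apply_symm_apply]; exact hw, rfl⟩
        rw [h, Subgroup.mem_bot] at h1
        rw [AddSubgroup.mem_bot]
        apply hext
        rw [ofAdd_zero, map_one]
        exact h1
      · rw [eq_top_iff]
        intro w _
        have h1 : ((e.symm (Multiplicative.ofAdd w) : N) : G) ∈ W'.map N.subtype := by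
          rw [h]; exact (e.symm (Multiplicative.ofAdd w)).2
        obtain ⟨x, hx, hxe⟩ := h1
        have h2 : x = e.symm (Multiplicative.ofAdd w) := Subtype.ext hxe
        have h3 := (hmemW x).1 hx
        rw [h2, MulEquiv.apply_symm_apply] at h3
        exact h3
  have hb := bound_irr ρ q k (hVcard.trans hN) (hVcard ▸ hqN) hirr
  rw [hVcard] at hb
  have h1 : (commutator G).index ≤ (commutator H).index := by
    apply comm_index_le_of_sup
    rw [eq_top_iff, ← hsup]; exact sup_le_sup_left hNG H
  have h2 := index_le_formula ρ.ker
  rw [relIndex_comm_self] at h2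
  have hker : ∀ c ∈ ρ.ker, ∀ n ∈ N, (c : G) * n = n * c := by
    intro c hc n hn
    have h3 : ρ c (Multiplicative.toAdd (e ⟨n, hn⟩)) = Multiplicative.toAdd (e ⟨n, hn⟩) := by
      rw [MonoidHom.mem_ker.1 hc]; rfl
    have h4 := hact' c (Multiplicative.toAdd (e ⟨n, hn⟩))
    rw [← hρ, h3, ofAdd_toAdd, MulEquiv.symm_apply_apply] at h4
    have h5 : n = c * n * (c : G)⁻¹ := h4
    exact (eq_mul_inv_iff_mul_eq.1 h5).symm
  let j : ρ.ker × N →* G :=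
    { toFun := fun x => ((x.1 : H) : G) * (x.2 : G)
      map_one' := by simp
      map_mul' := by
        rintro ⟨c, n⟩ ⟨c', n'⟩
        have := hker c' c'.2 n n.2
        change ((c : H) : G) * ((c' : H) : G) * ((n : G) * n')
          = (c : H) * (n : G) * ((c' : H) * n')
        rw [mul_assoc, mul_assoc, ← mul_assoc ((c' : H) : G), this, mul_assoc] }
  have hj : Function.Injective j := by
    rw [injective_iff_map_eq_one]
    rintro ⟨c, n⟩ hcn
    have h3 : ((c : H) : G) * (n : G) = 1 := hcn
    have h4 : (n : G) ∈ H ⊓ N := by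
      refine ⟨?_, n.2⟩
      rw [eq_inv_of_mul_eq_one_right h3]
      exact H.inv_mem (c : H).2
    rw [hinf, Subgroup.mem_bot] at h4
    rw [h4, mul_one] at h3
    exact Prod.ext (Subtype.ext (Subtype.ext h3)) (Subtype.ext h4)
  have h3 := hG j.range
  rw [← comm_index_congr (MonoidHom.ofInjective hj)] at h3
  have h4 : commutator (ρ.ker × N) = (commutator ρ.ker).prod (commutator N) := by
    rw [_root_.commutator_def, ← Subgroup.top_prod_top, Subgroup.commutator_prod_prod]; rfl
  have h5 : commutator N = ⊥ := by
    have : ⁅N, N⁆ = ⊥ := Subgroup.commutator_eq_bot_iff_le_centralizer.2 hNc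
    rw [← Subgroup.map_subtype_commutator] at this
    exact (Subgroup.map_eq_bot_iff_of_injective _ N.subtype_injective).1 this
  rw [h4, Subgroup.index_prod, h5, Subgroup.index_bot] at h3
  have h6 : 0 < (commutator ρ.ker).index := Nat.pos_of_ne_zero Subgroup.index_ne_zero_of_finite
  have h7 := Nat.mul_lt_mul_of_pos_right hb h6
  rw [mul_comm] at h3
  omega

theorem nilpotent_of_wtop : ∀ (n : ℕ) (G : Type u) [Group G] [Finite G], Nat.card G = n →
    WTop G → Group.IsNilpotent G := by
  intro n
  induction n using Nat.strong_induction_on with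
  | _ n IH =>
  intro G _ _ hcard hG
  subst hcard
  have htfae : Group.IsNilpotent G ↔ ∀ H : Subgroup G, IsCoatom H → H.Normal :=
    (Group.isNilpotent_of_finite_tfae (G := G)).out 0 2
  by_contra hnil
  have hG' : commutator G ≠ ⊥ := by
    intro h
    apply hnil
    rw [htfae]
    intro H _
    constructor
    intro x hx g
    have : ⁅g, x⁆ ∈ commutator G :=
      Subgroup.commutator_mem_commutator (Subgroup.mem_top _) (Subgroup.mem_top _)
    rw [h, Subgroup.mem_bot, commutatorElement_eq_one_iff_mul_comm] at this
    rw [this, mul_inv_cancel_right]; exact hx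
  obtain ⟨N, hNle, hNmin⟩ := Finite.exists_le_minimal (α := Subgroup G) (a := commutator G)
    (p := fun K : Subgroup G => K.Normal ∧ K ≠ ⊥ ∧ K ≤ commutator G)
    ⟨inferInstance, hG', le_rfl⟩
  obtain ⟨hNn, hN0, hNG⟩ := hNmin.prop
  have hmin : ∀ K : Subgroup G, K ≤ N → K.Normal → K = ⊥ ∨ K = N := by
    intro K hK hKn
    by_cases h : K = ⊥
    · exact Or.inl h
    · exact Or.inr (le_antisymm hK (hNmin.le_of_le ⟨hKn, h, hK.trans hNG⟩ hK))
  have hqs := QuotientGroup.mk'_surjective N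
  have hQnil : Group.IsNilpotent (G ⧸ N) := by
    refine IH _ ?_ (G ⧸ N) rfl (hG.quot (QuotientGroup.mk' N) hqs
      (by rw [QuotientGroup.ker_mk']; exact hNG))
    have h1 := Subgroup.card_mul_index N
    have h2 : 1 < Nat.card N := (Subgroup.one_lt_card_iff_ne_bot _).2 hN0
    have h3 : 0 < N.index := Nat.pos_of_ne_zero Subgroup.index_ne_zero_of_finite
    change N.index < _
    rw [← h1]
    exact lt_mul_of_one_lt_left h3 h2
  have hN1 : Nat.card N ≠ 1 := ((Subgroup.one_lt_card_iff_ne_bot _).2 hN0).ne'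
  obtain ⟨q, hqp, hqN⟩ := Nat.exists_prime_and_dvd hN1
  have : Fact q.Prime := ⟨hqp⟩
  obtain ⟨Q⟩ : Nonempty (Sylow q N) := inferInstance
  have hQn := sylow_normal hG (fun H hH hw => IH _ hH H rfl hw) N hNG hmin q hqN Q
  have hQcard : Nat.card ((Q : Subgroup N).map N.subtype) = Nat.card (Q : Subgroup N) :=
    (Nat.card_congr ((Q : Subgroup N).equivMapOfInjective N.subtype N.subtype_injective).toEquiv).symm
  have hQN : (Q : Subgroup N).map N.subtype = N := by
    refine (hmin _ (by rintro _ ⟨x, _, rfl⟩; exact x.2) hQn).resolve_left ?_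
    intro h
    rw [h, Subgroup.card_bot] at hQcard
    have h4 := Q.dvd_card_of_dvd_card hqN
    rw [← hQcard] at h4
    exact hqp.one_lt.ne' (Nat.dvd_one.1 h4)
  obtain ⟨k, hk⟩ := IsPGroup.iff_card.1 Q.isPGroup'
  have hNk : Nat.card N = q ^ k := by rw [← hk, ← hQcard, hQN]
  have hNp : Group.IsNilpotent N := (IsPGroup.of_card hNk).isNilpotent
  have hNN : ⁅N, N⁆ = ⊥ := by
    rcases hmin ⁅N, N⁆ (Subgroup.commutator_le_self N) inferInstance with h | h
    · exact h
    · exfalso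
      have h1 : commutator N = ⊤ := by
        apply Subgroup.map_injective N.subtype_injective
        rw [Subgroup.map_subtype_commutator, h, ← MonoidHom.range_eq_map, Subgroup.range_subtype]
      have h2 := nilp_sup (⊥ : Subgroup N) ⊤ (by rw [← commutator_def, h1]; exact le_sup_right)
      have h3 : Nat.card N = 1 := by
        rw [← Subgroup.card_top, le_bot_iff.1 h2, Subgroup.card_bot]
      exact hN1 h3
  have hNc : N ≤ Subgroup.centralizer (N : Set G) :=
    Subgroup.commutator_eq_bot_iff_le_centralizer.1 hNN
  have hex : ∃ H : Subgroup G, IsCoatom H ∧ ¬ H.Normal := by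
    by_contra! h
    exact hnil (htfae.2 h)
  obtain ⟨H, hH, hHn⟩ := hex
  have hNH : ¬ N ≤ H := by
    intro hle
    apply hHn
    have hcm : (H.map (QuotientGroup.mk' N)).comap (QuotientGroup.mk' N) = H := by
      apply Subgroup.comap_map_eq_self
      rw [QuotientGroup.ker_mk']; exact hle
    rw [← hcm]
    have hco : IsCoatom (H.map (QuotientGroup.mk' N)) := by
      refine ⟨?_, ?_⟩
      · intro h
        rw [h, Subgroup.comap_top] at hcm
        exact hH.1 hcm.symm
      · intro K hK
        have h1 : H < K.comap (QuotientGroup.mk' N) := by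
          rw [← hcm]
          exact (Subgroup.comap_lt_comap_of_surjective hqs).2 hK
        have h2 := hH.2 _ h1
        rw [← Subgroup.map_comap_eq_self_of_surjective hqs K, h2,
          Subgroup.map_top_of_surjective _ hqs]
    have := coatom_normal hco
    infer_instance
  have hsup : H ⊔ N = ⊤ := by
    apply hH.2
    refine lt_of_le_of_ne le_sup_left ?_
    intro h
    exact hNH (h ▸ le_sup_right)
  have hinfn : (H ⊓ N).Normal := by
    rw [← Subgroup.normalizer_eq_top_iff, eq_top_iff, ← hsup]
    refine sup_le ?_ ?_
    · intro h hh
      apply Subgroup.mem_normalizer_fintype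
      intro x hx
      exact ⟨H.mul_mem (H.mul_mem hh hx.1) (H.inv_mem hh), hNn.conj_mem x hx.2 h⟩
    · intro n hn
      apply Subgroup.mem_normalizer_fintype
      intro x hx
      have : n * x = x * n := (Subgroup.mem_centralizer_iff.1 (hNc hx.2) n hn)
      rw [this, mul_inv_cancel_right]; exact hx
  have hinf : H ⊓ N = ⊥ := by
    refine (hmin _ inf_le_right hinfn).resolve_right ?_
    intro h
    exact hNH (h ▸ inf_le_left)
  have hHnil : Group.IsNilpotent H := by
    refine Subgroup.isNilpotent_of_ker_le_center ((QuotientGroup.mk' N).comp H.subtype) ?_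
    intro x hx
    have h1 : (x : G) ∈ N := (QuotientGroup.eq_one_iff (x : G)).1 hx
    have h2 : (x : G) ∈ H ⊓ N := ⟨x.2, h1⟩
    rw [hinf, Subgroup.mem_bot] at h2
    have h3 : x = 1 := Subtype.ext h2
    rw [h3]; exact one_mem _
  exact affine_case hG N H hNG hNc hN0 hmin q k hNk hqN hsup hinf

end WT

/-- Every finite weakly-top group is solvable. -/
theorem weakly_top_solvable (G : Type*) [Group G] [Finite G]
    (hG : IsWeaklyTop G) : IsSolvable G := by
  have h : Group.IsNilpotent G := WT.nilpotent_of_wtop _ G rfl (fun H => hG H)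
  have h2 : Group.IsSolvable G := inferInstance
  exact h2
end

section
/- Every finite top group G satisfies G' ≤ Z(G), i.e., is nilpotent of class at most 2. -/
def IsTopGroup (G : Type*) [Group G] : Prop :=
  ∀ H : Subgroup G, H ≠ ⊤ →
    Nat.card (Abelianization H) < Nat.card (Abelianization G)

open scoped commutatorElement IsMulCommutative

theorem top_quot {G : Type*} [Group G] [Finite G] (hG : IsTopGroup G) (N : Subgroup G) [N.Normal]
    (hN : N ≤ commutator G) : IsTopGroup (G ⧸ N) := by
  intro H hH
  have hne : H.comap (QuotientGroup.mk' N) ≠ ⊤ := by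
    intro h
    apply hH
    rw [← Subgroup.map_comap_eq_self_of_surjective (QuotientGroup.mk'_surjective N) H, h,
      Subgroup.map_top_of_surjective _ (QuotientGroup.mk'_surjective N)]
  have h1 := hG _ hne
  have : Finite (Abelianization (H.comap (QuotientGroup.mk' N))) :=
    Quotient.finite _
  have : Finite (Abelianization (G ⧸ N)) :=
    Quotient.finite _
  have h2 : Nat.card (Abelianization H) ≤
      Nat.card (Abelianization (H.comap (QuotientGroup.mk' N))) := by
    let f := Abelianization.map ((QuotientGroup.mk' N).subgroupComap H)
    refine Nat.card_le_card_of_surjective f ?_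
    intro y
    obtain ⟨⟨y, hy⟩, rfl⟩ := QuotientGroup.mk_surjective y
    obtain ⟨g, rfl⟩ := QuotientGroup.mk'_surjective N y
    exact ⟨Abelianization.of ⟨g, hy⟩, rfl⟩
  have h3 : Nat.card (Abelianization G) ≤ Nat.card (Abelianization (G ⧸ N)) := by
    let f : Abelianization (G ⧸ N) →* Abelianization G :=
      Abelianization.lift (QuotientGroup.lift N Abelianization.of
        (fun x hx => by
          have := hN hx
          rwa [← Abelianization.ker_of] at this))
    refine Nat.card_le_card_of_surjective f ?_
    intro y
    obtain ⟨g, rfl⟩ := QuotientGroup.mk_surjective y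
    exact ⟨Abelianization.of (g : G ⧸ N), rfl⟩
  omega

theorem top_nilp {G : Type*} [Group G] [Finite G] (hG : IsTopGroup G) : Group.IsNilpotent G := by
  refine ((Group.isNilpotent_of_finite_tfae (G := G)).out 0 2 :
    Group.IsNilpotent G ↔ ∀ H : Subgroup G, IsCoatom H → H.Normal).2 ?_
  intro H hH
  have hle : commutator G ≤ H := by
    by_contra hc
    have hs : H ⊔ commutator G = ⊤ := hH.2 _ (lt_of_le_of_ne le_sup_left (by
      intro h; apply hc; rw [h]; exact le_sup_right))
    have h1 := hG H hH.1
    have : Finite (Abelianization H) := Quotient.finite _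
    have h2 : Nat.card (Abelianization G) ≤ Nat.card (Abelianization H) := by
      refine Nat.card_le_card_of_surjective (Abelianization.map H.subtype) ?_
      intro y
      obtain ⟨g, rfl⟩ := QuotientGroup.mk_surjective y
      have hg : g ∈ H ⊔ commutator G := by rw [hs]; trivial
      rw [Subgroup.mem_sup_of_normal_right] at hg
      obtain ⟨h, hh, c, hc, rfl⟩ := hg
      refine ⟨Abelianization.of ⟨h, hh⟩, ?_⟩
      change Abelianization.of h = Abelianization.of (h * c)
      rw [← Abelianization.ker_of, MonoidHom.mem_ker] at hc
      rw [map_mul, hc, mul_one]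
    omega
  exact Subgroup.Normal.of_commutator_le _ hle

theorem comm_mem_left {G : Type*} [Group G] (x y : G) : ⁅x, y⁆ ∈ commutator G :=
  Subgroup.commutator_mem_commutator (Subgroup.mem_top _) (Subgroup.mem_top _)

theorem card_ab {G : Type*} [Group G] :
    Nat.card (Abelianization G) * Nat.card (commutator G) = Nat.card G :=
  (Subgroup.card_eq_card_quotient_mul_card_subgroup _).symm

theorem conj_central {G : Type*} [Group G] (x c : G) (hc : c ∈ Subgroup.center G) :
    x * c * x⁻¹ = c := by
  rw [Subgroup.mem_center_iff] at hc
  rw [hc x, mul_inv_cancel_right]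

theorem hall_witt_central {G : Type*} [Group G] (x y z : G)
    (h : ∀ d ∈ commutator G, ∀ g : G, ⁅d, g⁆ ∈ Subgroup.center G) :
    ⁅⁅x, y⁆, z⁆⁻¹ = ⁅⁅z⁻¹, x⁻¹⁆, y⁆ * ⁅⁅y⁻¹, z⁆, x⁻¹⁆ := by
  have hA := h _ (comm_mem_left z⁻¹ x⁻¹) y
  have hB := h _ (comm_mem_left y⁻¹ z) x⁻¹
  calc ⁅⁅x, y⁆, z⁆⁻¹
      = x * ((z * ⁅⁅z⁻¹, x⁻¹⁆, y⁆ * z⁻¹) * (y * ⁅⁅y⁻¹, z⁆, x⁻¹⁆ * y⁻¹)) * x⁻¹ := by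
        simp only [commutatorElement_def]; group
    _ = _ := by
        rw [conj_central z _ hA, conj_central y _ hB, conj_central _ _ (mul_mem hA hB)]

theorem top_class_three {G : Type*} [Group G] [Finite G] (hG : IsTopGroup G)
    (h : ∀ d ∈ commutator G, ∀ g : G, ⁅d, g⁆ ∈ Subgroup.center G) :
    commutator G ≤ Subgroup.center G := by
  intro d₀ hd₀
  by_contra hcon
  obtain ⟨g₀, hg₀⟩ : ∃ g₀ : G, ⁅d₀, g₀⁆ ≠ 1 := by
    by_contra! hall
    apply hcon
    rw [Subgroup.mem_center_iff]
    intro g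
    exact (commutatorElement_eq_one_iff_mul_comm.mp (hall g)).symm
  obtain ⟨χ, hχ⟩ := CommGroup.exists_apply_ne_one_of_hasEnoughRootsOfUnity
    (Subgroup.center G) ℂ (a := ⟨⁅d₀, g₀⁆, h d₀ hd₀ g₀⟩)
    (fun hh => hg₀ (congrArg Subtype.val hh))
  let ψ : commutator G →* (G →* ℂˣ) :=
    { toFun := fun d =>
        { toFun := fun g => χ ⟨⁅(d : G), g⁆, h d d.2 g⟩
          map_one' := by
            rw [← map_one χ]; congr 1; ext; simp
          map_mul' := fun a b => by
            rw [← map_mul]; congr 1; ext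
            change ⁅(d : G), a * b⁆ = ⁅(d : G), a⁆ * ⁅(d : G), b⁆
            rw [← conj_central a _ (h d d.2 b)]
            simp only [commutatorElement_def]; group }
      map_one' := by
        ext g : 1
        change χ _ = 1
        rw [← map_one χ]; congr 1; ext; simp
      map_mul' := fun d e => by
        ext g : 1
        change χ _ = χ _ * χ _
        rw [← map_mul]; congr 1; ext
        change ⁅(d : G) * e, g⁆ = ⁅(d : G), g⁆ * ⁅(e : G), g⁆
        rw [← Subgroup.mem_center_iff.mp (h d d.2 g) ⁅(e : G), g⁆,
          ← conj_central (d : G) _ (h e e.2 g)]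
        simp only [commutatorElement_def]; group }
  have hψ : ∀ (d : commutator G) (g : G), ψ d g = χ ⟨⁅(d : G), g⁆, h d d.2 g⟩ := fun _ _ => rfl
  let ev : G →* (ψ.range →* ℂˣ) :=
    { toFun := fun g =>
        { toFun := fun a => a.1 g
          map_one' := rfl
          map_mul' := fun _ _ => rfl }
      map_one' := by ext a : 1; exact map_one a.1
      map_mul' := fun x y => by ext a : 1; exact map_mul a.1 x y }
  have hev : ∀ g, g ∈ ev.ker ↔ ∀ d, ψ d g = 1 := by
    intro g
    rw [MonoidHom.mem_ker]
    constructor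
    · intro hg d
      exact DFunLike.congr_fun hg ⟨ψ d, d, rfl⟩
    · intro hg
      ext a : 1
      obtain ⟨_, d, rfl⟩ := a
      exact hg d
  have hK : ev.ker ≠ ⊤ := by
    intro htop
    have : g₀ ∈ ev.ker := by rw [htop]; trivial
    exact hχ ((hev g₀).1 this ⟨d₀, hd₀⟩)
  have hfin : Finite ψ.range := Set.finite_range ψ
  have hcard := CommGroup.card_monoidHom_of_hasEnoughRootsOfUnity ψ.range ℂ
  have hfin2 : Finite (ψ.range →* ℂˣ) :=
    Nat.finite_of_card_ne_zero (by rw [hcard]; exact Nat.card_pos.ne')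
  have hidx : ev.ker.index ≤ Nat.card ψ.range := by
    rw [Subgroup.index_ker, ← hcard]
    exact Nat.card_le_card_of_injective _ (Subtype.val_injective)
  have hle : (commutator ev.ker).map ev.ker.subtype ≤ ψ.ker.map (commutator G).subtype := by
    rw [Subgroup.map_subtype_commutator, Subgroup.commutator_le]
    intro x hx y hy
    refine ⟨⟨⁅x, y⁆, comm_mem_left x y⟩, ?_, rfl⟩
    change ψ _ = 1
    ext z : 1
    change ψ _ z = 1
    rw [← inv_eq_one, hψ, ← map_inv]
    have hx' := inv_mem hx
    have e1 := (hev y).1 hy ⟨⁅z⁻¹, x⁻¹⁆, comm_mem_left _ _⟩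
    have e2 := (hev x⁻¹).1 hx' ⟨⁅y⁻¹, z⁆, comm_mem_left _ _⟩
    rw [hψ] at e1 e2
    rw [← mul_one (1 : ℂˣ)]
    nth_rewrite 1 [← e1]
    rw [← e2, ← map_mul]
    congr 1
    ext
    exact hall_witt_central x y z h
  have hcl : Nat.card (commutator ev.ker) ≤ Nat.card ψ.ker := by
    have a1 : Nat.card ((commutator ev.ker).map ev.ker.subtype) = _ :=
      Subgroup.card_map_of_injective ev.ker.subtype_injective
    have a2 : Nat.card (ψ.ker.map (commutator G).subtype) = _ :=
      Subgroup.card_map_of_injective (commutator G).subtype_injective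
    rw [← a1, ← a2]
    exact Subgroup.card_le_of_le hle
  have c1 := card_ab (G := G)
  have c2 := card_ab (G := ev.ker)
  have c3 := ev.ker.card_mul_index
  have c4 := ψ.ker.card_mul_index
  rw [Subgroup.index_ker] at c4
  have hlt := hG _ hK
  have p1 : 0 < Nat.card ψ.ker := Nat.card_pos
  have p2 : 0 < Nat.card ψ.range := Nat.card_pos
  have key : Nat.card (Abelianization G) * (Nat.card ψ.ker * Nat.card ψ.range) ≤
      Nat.card (Abelianization ev.ker) * (Nat.card ψ.ker * Nat.card ψ.range) := by
    rw [c4, c1, ← c3, ← c2, ← c4, mul_assoc]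
    gcongr
  have := Nat.le_of_mul_le_mul_right key (Nat.mul_pos p1 p2)
  omega

/-- Every finite top group `G` satisfies `G' ≤ Z(G)`. -/
theorem top_group_class_two (G : Type*) [Group G] [Finite G]
    (hG : IsTopGroup G) : commutator G ≤ Subgroup.center G := by
  have hnil := top_nilp hG
  let L := (⊤ : Subgroup G).lowerCentralSeries
  have hs : ∀ n, L (n + 1) = ⁅L n, ⊤⁆ := fun n => Subgroup.lowerCentralSeries_succ _ n
  have h1 : L 1 = commutator G := Subgroup.top_lowerCentralSeries_one
  have hanti : Antitone L := Subgroup.lowerCentralSeries_antitone _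
  have hnorm : (L 3).Normal := by
    have : ∀ n, (L n).Normal := by
      intro n
      induction n with
      | zero => exact inferInstanceAs (⊤ : Subgroup G).Normal
      | succ n ih => rw [hs]; infer_instance
    exact this 3
  have hle : L 3 ≤ commutator G := h1 ▸ hanti (by norm_num)
  have hQ := top_quot hG (L 3) hle
  have hmap : (commutator G).map (QuotientGroup.mk' (L 3)) = commutator (G ⧸ L 3) := by
    rw [commutator_def, commutator_def, Subgroup.map_commutator,
      Subgroup.map_top_of_surjective _ (QuotientGroup.mk'_surjective _)]
  have hcen := top_class_three hQ (by
    rw [← hmap]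
    rintro _ ⟨d, hd, rfl⟩ g
    obtain ⟨g, rfl⟩ := QuotientGroup.mk'_surjective _ g
    rw [← map_commutatorElement, Subgroup.mem_center_iff]
    intro k
    obtain ⟨k, rfl⟩ := QuotientGroup.mk'_surjective _ k
    symm
    rw [← commutatorElement_eq_one_iff_mul_comm, ← map_commutatorElement]
    refine (QuotientGroup.eq_one_iff _).2 ?_
    rw [hs 2, hs 1, h1]
    exact Subgroup.commutator_mem_commutator
      (Subgroup.commutator_mem_commutator hd (Subgroup.mem_top _)) (Subgroup.mem_top _))
  have h23 : L 2 ≤ L 3 := by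
    rw [hs 1, h1, Subgroup.commutator_le]
    intro d hd g _
    have hm : QuotientGroup.mk' (L 3) d ∈ Subgroup.center (G ⧸ L 3) :=
      hcen (hmap ▸ Subgroup.mem_map_of_mem _ hd)
    have := (Subgroup.mem_center_iff.mp hm (QuotientGroup.mk' (L 3) g)).symm
    rw [← commutatorElement_eq_one_iff_mul_comm, ← map_commutatorElement] at this
    exact (QuotientGroup.eq_one_iff _).1 this
  have hall : ∀ n, L 2 ≤ L (n + 2) := by
    intro n
    induction n with
    | zero => exact le_rfl
    | succ n ih =>
      refine h23.trans ?_
      rw [hs 2, show n + 1 + 2 = (n + 2) + 1 from rfl, hs (n + 2)]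
      exact Subgroup.commutator_mono ih le_rfl
  obtain ⟨n, hn⟩ := Subgroup.nilpotent_iff_lowerCentralSeries.mp hnil
  have hbot : L 2 = ⊥ := by
    rw [eq_bot_iff]
    refine (hall n).trans ((hanti (Nat.le_add_right n 2)).trans ?_)
    exact hn.le
  intro d hd
  rw [Subgroup.mem_center_iff]
  intro g
  have : ⁅d, g⁆ ∈ L 2 := by
    rw [hs 1, h1]
    exact Subgroup.commutator_mem_commutator hd (Subgroup.mem_top _)
  rw [hbot, Subgroup.mem_bot] at this
  exact (commutatorElement_eq_one_iff_mul_comm.mp this).symm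
end

section
/- Every non-abelian finite top group G satisfies |G/G'| > |G|^{1/2}. -/
theorem topAux_card_le_of_surj {A B : Type*} [Group A] [Finite A] [Group B]
    (f : A →* B) (hf : Function.Surjective f) :
    Nat.card (Abelianization B) ≤ Nat.card (Abelianization A) := by
  have : Finite (Abelianization A) := Finite.of_surjective (Abelianization.of (G := A))
    QuotientGroup.mk_surjective
  apply Nat.card_le_card_of_surjective (Abelianization.map f)
  intro y
  obtain ⟨b, rfl⟩ := QuotientGroup.mk_surjective y
  obtain ⟨a, rfl⟩ := hf b
  exact ⟨Abelianization.of a, rfl⟩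

theorem topAux_card_le_of_surj_ab {A B : Type*} [Group A] [Finite A] [CommGroup B]
    (f : A →* B) (hf : Function.Surjective f) :
    Nat.card B ≤ Nat.card (Abelianization A) := by
  rw [Nat.card_congr (Abelianization.equivOfComm (H := B)).toEquiv]
  exact topAux_card_le_of_surj f hf

theorem topAux_nilpotent (G : Type*) [Group G] [Finite G] (hG : IsTopGroup G) :
    Group.IsNilpotent G := by
  refine (Group.isNilpotent_of_finite_tfae.out 0 2 rfl rfl).mpr ?_
  intro M hM
  apply Subgroup.Normal.of_commutator_le
  by_contra hle
  have hsup : M ⊔ commutator G = ⊤ := hM.2 _ (by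
    refine lt_of_le_of_ne le_sup_left ?_
    intro h
    exact hle (h ▸ le_sup_right))
  have h1 := hG M hM.1
  refine absurd h1 (not_lt.mpr ?_)
  apply topAux_card_le_of_surj_ab ((Abelianization.of (G := G)).comp M.subtype)
  intro y
  obtain ⟨g, rfl⟩ := QuotientGroup.mk_surjective y
  have hg : g ∈ M ⊔ commutator G := hsup ▸ Subgroup.mem_top g
  obtain ⟨m, hm, c, hc, rfl⟩ := Subgroup.mem_sup_of_normal_right.mp hg
  refine ⟨⟨m, hm⟩, ?_⟩
  have : Abelianization.of (m * c) = Abelianization.of m := by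
    rw [map_mul, (show Abelianization.of c = 1 from by
      rw [← MonoidHom.mem_ker, Abelianization.ker_of]; exact hc), mul_one]
  exact this.symm

theorem topAux_quotient (G : Type*) [Group G] [Finite G] (hG : IsTopGroup G)
    (N : Subgroup G) [N.Normal] (hN : N ≤ commutator G) : IsTopGroup (G ⧸ N) := by
  intro H hH
  have hs : Function.Surjective (QuotientGroup.mk' N) := QuotientGroup.mk'_surjective N
  have h1 : Nat.card (Abelianization H) ≤
      Nat.card (Abelianization (H.comap (QuotientGroup.mk' N))) := by
    apply topAux_card_le_of_surj ((QuotientGroup.mk' N).subgroupComap H)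
    exact MonoidHom.subgroupComap_surjective_of_surjective _ _ hs
  have h2 : Nat.card (Abelianization G) ≤ Nat.card (Abelianization (G ⧸ N)) := by
    apply topAux_card_le_of_surj_ab (QuotientGroup.lift N (Abelianization.of (G := G)) ?_)
    · intro y
      obtain ⟨g, rfl⟩ := QuotientGroup.mk_surjective y
      exact ⟨(g : G ⧸ N), rfl⟩
    · intro x hx
      have := hN hx
      rwa [← Abelianization.ker_of] at this
  have h3 := hG (H.comap (QuotientGroup.mk' N)) (by
    intro h
    apply hH
    rw [← Subgroup.map_comap_eq_self_of_surjective hs H, h]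
    exact Subgroup.map_top_of_surjective _ hs)
  omega

theorem topAux_embed (N : Type*) [Group N] [Finite N] [IsCyclic N] :
    ∃ j : N →* ℂˣ, Function.Injective j := by
  have : NeZero (Nat.card N) := ⟨Nat.card_pos.ne'⟩
  let e : N ≃* rootsOfUnity (Nat.card N) ℂ :=
    mulEquivOfCyclicCardEq (Complex.card_rootsOfUnity _).symm
  exact ⟨(Subgroup.subtype _).comp e.toMonoidHom,
    (Subgroup.subtype_injective _).comp e.injective⟩

theorem topAux_hom_card (A : Type*) [Group A] [Finite A] :
    Finite (A →* ℂˣ) ∧ Nat.card (A →* ℂˣ) ≤ Nat.card A := by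
  have hf : Finite (Abelianization A) := Finite.of_surjective (Abelianization.of (G := A))
    QuotientGroup.mk_surjective
  have : NeZero (Monoid.exponent (Abelianization A)) :=
    ⟨Monoid.exponent_ne_zero_of_finite⟩
  have h := CommGroup.card_monoidHom_of_hasEnoughRootsOfUnity (Abelianization A) ℂ
  have h2 := Nat.card_congr (Abelianization.lift (G := A) (A := ℂˣ))
  constructor
  · have := Nat.finite_of_card_ne_zero (α := A →* ℂˣ) (by rw [h2, h]; exact Nat.card_pos.ne')
    exact this
  · rw [h2, h]
    exact Nat.card_le_card_of_surjective (Abelianization.of (G := A)) QuotientGroup.mk_surjective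

open scoped commutatorElement in
theorem topAux_index (G : Type*) [Group G] [Finite G] (N : Subgroup G) [IsCyclic N]
    (hNc : N ≤ Subgroup.center G) (h3 : ⁅commutator G, (⊤ : Subgroup G)⁆ ≤ N) :
    (Subgroup.centralizer (commutator G : Set G)).index ≤
      ((Subgroup.center G).subgroupOf (commutator G)).index := by
  obtain ⟨j, hj⟩ := topAux_embed N
  let K := (Subgroup.center G).subgroupOf (commutator G)
  have hmem : ∀ (x : commutator G) (g : G), ⁅(x : G), g⁆ ∈ N := fun x g =>
    h3 (Subgroup.commutator_mem_commutator x.2 (Subgroup.mem_top g))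
  let φ : G → (commutator G →* N) := fun g =>
    MonoidHom.mk' (fun x => ⟨⁅(x : G), g⁆, hmem x g⟩) (by
      intro x y
      apply Subtype.ext
      have hy := Subgroup.mem_center_iff.mp (hNc (hmem y g)) x
      have hxy := Subgroup.mem_center_iff.mp (hNc (hmem y g)) ⁅(x : G), g⁆
      show ⁅(x : G) * y, g⁆ = ⁅(x : G), g⁆ * ⁅(y : G), g⁆
      have : ⁅(x : G) * y, g⁆ = x * ⁅(y : G), g⁆ * (x : G)⁻¹ * ⁅(x : G), g⁆ := by
        simp only [commutatorElement_def]; group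
      rw [this, hy, mul_inv_cancel_right, hxy])
  have hφ : ∀ g x, ((φ g x : N) : G) = ⁅(x : G), g⁆ := fun g x => rfl
  have hK : ∀ g, ∀ x ∈ K, (j.comp (φ g)) x = 1 := by
    intro g x hx
    have : φ g x = 1 := by
      apply Subtype.ext
      rw [hφ]
      have := Subgroup.mem_center_iff.mp (Subgroup.mem_subgroupOf.mp hx) g
      exact commutatorElement_eq_one_iff_mul_comm.mpr this.symm
    simp [this]
  let ψ : G → ((commutator G ⧸ K) →* ℂˣ) := fun g => QuotientGroup.lift K (j.comp (φ g)) (hK g)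
  obtain ⟨hfin, hcard⟩ := topAux_hom_card (commutator G ⧸ K)
  refine le_trans ?_ hcard
  apply Nat.card_le_card_of_injective
    (fun q : G ⧸ (Subgroup.centralizer (commutator G : Set G)) => ψ q.out)
  intro a b hab
  replace hab : ψ (Quotient.out a) = ψ (Quotient.out b) := hab
  rw [← Quotient.out_eq a, ← Quotient.out_eq b]
  apply QuotientGroup.eq.mpr
  generalize Quotient.out a = g at *
  generalize Quotient.out b = h at *
  rw [Subgroup.mem_centralizer_iff]
  intro x hx
  have h1 : ψ g ((⟨x, hx⟩ : commutator G) : commutator G ⧸ K) =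
    ψ h ((⟨x, hx⟩ : commutator G) : commutator G ⧸ K) := DFunLike.congr_fun hab _
  have h2 : φ g ⟨x, hx⟩ = φ h ⟨x, hx⟩ := hj h1
  have h4 : ⁅x, g⁆ = ⁅x, h⁆ := congrArg Subtype.val h2
  simp only [commutatorElement_def, mul_assoc, mul_right_inj] at h4
  have h5 : g * x * g⁻¹ = h * x * h⁻¹ := by
    have := congrArg (·⁻¹) h4
    simpa [mul_assoc] using this
  calc x * (g⁻¹ * h) = g⁻¹ * (g * x * g⁻¹) * h := by group
    _ = g⁻¹ * h * x := by rw [h5]; group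

theorem topAux_step (G : Type*) [Group G] [Finite G] (hG : IsTopGroup G)
    (N : Subgroup G) [IsCyclic N]
    (hNc : N ≤ Subgroup.center G) (h3 : ⁅commutator G, (⊤ : Subgroup G)⁆ ≤ N) :
    Subgroup.centralizer (commutator G : Set G) = ⊤ := by
  by_contra hC
  have hidx := topAux_index G N hNc h3
  have hlt := hG _ hC
  set C := Subgroup.centralizer (commutator G : Set G) with hCdef
  set K := (Subgroup.center G).subgroupOf (commutator G) with hKdef
  have hDC : ⁅commutator G, C⁆ = ⊥ := by
    rw [Subgroup.commutator_comm, Subgroup.commutator_eq_bot_iff_le_centralizer]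
  have hrot : ⁅⁅C, C⁆, (⊤ : Subgroup G)⁆ = ⊥ := by
    apply Subgroup.commutator_commutator_eq_bot_of_rotate
    · rw [eq_bot_iff, ← hDC]
      apply Subgroup.commutator_mono _ le_rfl
      exact Subgroup.commutator_mono le_top le_top
    · rw [eq_bot_iff, ← hDC]
      apply Subgroup.commutator_mono _ le_rfl
      exact Subgroup.commutator_mono le_top le_top
  have hCZ : ⁅C, C⁆ ≤ Subgroup.center G := by
    have := Subgroup.commutator_eq_bot_iff_le_centralizer.mp hrot
    simpa [Subgroup.centralizer_univ] using this
  have hCD : ⁅C, C⁆ ≤ commutator G := Subgroup.commutator_mono le_top le_top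
  have hk : Nat.card (commutator C) ≤ Nat.card K := by
    have hmap : ∀ x : commutator C, ((x : C) : G) ∈ ⁅C, C⁆ := by
      intro x
      have h : ((x : C) : G) ∈ (commutator C).map C.subtype := ⟨x, x.2, rfl⟩
      have e : (commutator C).map C.subtype = ⁅C, C⁆ := by
        rw [commutator_def, Subgroup.map_commutator, ← MonoidHom.range_eq_map,
          Subgroup.range_subtype]
      exact e ▸ h
    apply Nat.card_le_card_of_injective
      (fun x : commutator C => (⟨⟨((x : C) : G), hCD (hmap x)⟩,
        Subgroup.mem_subgroupOf.mpr (hCZ (hmap x))⟩ : K))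
    intro x y hxy
    have : ((x : C) : G) = ((y : C) : G) :=
      congrArg (fun t : K => ((t : commutator G) : G)) hxy
    exact Subtype.ext (Subtype.ext this)
  have e1 : Nat.card G = Nat.card (Abelianization G) * Nat.card (commutator G) :=
    Subgroup.card_eq_card_quotient_mul_card_subgroup _
  have e2 : Nat.card C = Nat.card (Abelianization C) * Nat.card (commutator C) :=
    Subgroup.card_eq_card_quotient_mul_card_subgroup _
  have e3 : Nat.card C * C.index = Nat.card G := Subgroup.card_mul_index _
  have e4 : Nat.card K * K.index = Nat.card (commutator G) := Subgroup.card_mul_index _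
  have hpos : 0 < Nat.card (commutator G) := Nat.card_pos
  have : Nat.card (Abelianization G) * Nat.card (commutator G) ≤
      Nat.card (Abelianization C) * Nat.card (commutator G) := by
    rw [← e1, ← e3, e2, ← e4, mul_assoc]
    exact Nat.mul_le_mul le_rfl (Nat.mul_le_mul hk hidx)
  exact absurd (Nat.le_of_mul_le_mul_right this hpos) (not_le.mpr hlt)

theorem topAux_central_elt (G : Type*) [Group G] [Group.IsNilpotent G]
    (h : ⁅commutator G, (⊤ : Subgroup G)⁆ ≠ ⊥) :
    ∃ z : G, z ≠ 1 ∧ z ∈ Subgroup.center G ∧ z ∈ commutator G := by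
  classical
  have hex : ∃ n, (⊤ : Subgroup G).lowerCentralSeries n = ⊥ :=
    Subgroup.nilpotent_iff_lowerCentralSeries.mp inferInstance
  have hspec := Nat.find_spec hex
  have hmin := fun m => Nat.find_min hex (m := m)
  generalize Nat.find hex = n at hspec hmin
  have h2 : 2 < n := by
    by_contra hn
    apply h
    have := Subgroup.lowerCentralSeries_antitone (⊤ : Subgroup G) (not_lt.mp hn)
    rw [hspec] at this
    exact le_bot_iff.mp this
  obtain ⟨m, rfl⟩ : ∃ m, n = m + 1 := ⟨n - 1, by omega⟩
  have hm := hmin m (by omega)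
  obtain ⟨⟨z, hz⟩, hz0⟩ := Subgroup.ne_bot_iff_exists_ne_one.mp hm
  have hz1 : z ≠ 1 := fun t => hz0 (Subtype.ext t)
  refine ⟨z, hz1, ?_, ?_⟩
  · rw [Subgroup.lowerCentralSeries_succ, Subgroup.commutator_eq_bot_iff_le_centralizer] at hspec
    have := hspec hz
    simpa [Subgroup.centralizer_univ] using this
  · have := Subgroup.lowerCentralSeries_antitone (⊤ : Subgroup G) (show 1 ≤ m by omega) hz
    exact this

theorem topAux_main (n : ℕ) : ∀ (G : Type*) [Group G] [Finite G], Nat.card G = n →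
    IsTopGroup G → ⁅commutator G, (⊤ : Subgroup G)⁆ = ⊥ := by
  induction n using Nat.strong_induction_on with
  | _ n ih =>
  intro G _ _ hn hG
  by_contra hne
  have := topAux_nilpotent G hG
  obtain ⟨z, hz1, hzc, hzd⟩ := topAux_central_elt G hne
  let N := Subgroup.zpowers z
  have hNc : N ≤ Subgroup.center G := Subgroup.zpowers_le.mpr hzc
  have hNd : N ≤ commutator G := Subgroup.zpowers_le.mpr hzd
  have hNn : N.Normal := ⟨fun x hx g => by
    rw [Subgroup.mem_center_iff.mp (hNc hx) g, mul_inv_cancel_right]; exact hx⟩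
  have hq := topAux_quotient G hG N hNd
  have hlt : Nat.card (G ⧸ N) < n := by
    have e := Subgroup.card_eq_card_quotient_mul_card_subgroup N
    have h1 : 1 < Nat.card N := by
      rw [Subgroup.one_lt_card_iff_ne_bot]
      exact fun h => hz1 (Subgroup.zpowers_eq_bot.mp h)
    have h0 : 0 < Nat.card (G ⧸ N) := Nat.card_pos
    rw [← hn, e]
    exact lt_mul_of_one_lt_right h0 h1
  have hb := ih _ hlt (G ⧸ N) rfl hq
  have h3 : ⁅commutator G, (⊤ : Subgroup G)⁆ ≤ N := by
    have hs : Function.Surjective (QuotientGroup.mk' N) := QuotientGroup.mk'_surjective N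
    rw [← QuotientGroup.ker_mk' N, ← Subgroup.map_eq_bot_iff, Subgroup.map_commutator,
      commutator_def, Subgroup.map_commutator, Subgroup.map_top_of_surjective _ hs]
    exact hb
  have hC := topAux_step G hG N hNc h3
  apply hne
  rw [Subgroup.commutator_comm, Subgroup.commutator_eq_bot_iff_le_centralizer, hC]

/-- Every non-abelian finite top group `G` satisfies `|G/G'| > |G|^(1/2)`,
i.e. `|G/G'|² > |G|`. -/
theorem top_group_large_abelianization (G : Type*) [Group G] [Finite G]
    (hG : IsTopGroup G) (hna : ¬ ∀ a b : G, a * b = b * a) :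
    Nat.card G < (Nat.card (Abelianization G)) ^ 2 := by
  have h := topAux_main _ G rfl hG
  have hle : commutator G ≤ Subgroup.center G := by
    have := Subgroup.commutator_eq_bot_iff_le_centralizer.mp h
    simpa [Subgroup.centralizer_univ] using this
  have hZ := hG (Subgroup.center G) (by
    intro ht
    apply hna
    intro a b
    exact Subgroup.mem_center_iff.mp (ht ▸ Subgroup.mem_top b) a)
  have hZ2 : Nat.card (Subgroup.center G) ≤ Nat.card (Abelianization (Subgroup.center G)) := by
    letI : CommGroup (Subgroup.center G) :=
      { (inferInstance : Group (Subgroup.center G)) with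
        mul_comm := fun a b => Subtype.ext (Subgroup.mem_center_iff.mp b.2 a) }
    exact topAux_card_le_of_surj_ab (MonoidHom.id _) Function.surjective_id
  replace hZ := lt_of_le_of_lt hZ2 hZ
  have h1 : Nat.card (commutator G) ≤ Nat.card (Subgroup.center G) :=
    Subgroup.card_le_of_le hle
  have e1 : Nat.card G = Nat.card (Abelianization G) * Nat.card (commutator G) :=
    Subgroup.card_eq_card_quotient_mul_card_subgroup _
  rw [e1, sq]
  exact Nat.mul_lt_mul_of_pos_left (lt_of_le_of_lt h1 hZ) (by omega)
end
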